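/- arXiv:2410.21994 — 2 statements merged into one kernel-verified Lean document; each statement's English description precedes it below -/
import Mathlib

section
/- Let α⁺, α⁻ : Ω → ℂ be smooth and set α̃⁺ = Δ(r)² r⁻³ α⁺ and α̃⁻ = r⁻³ α⁻. Define the operator □u = −(r²/Δ)∂ₜ²u + (1/r²)∂ᵣ(Δ ∂ᵣu) + (1/(r² sin ϑ))∂_ϑ(sin ϑ ∂_ϑ u) + (1/(r² sin²ϑ))∂_φ²u, and write Δ′(r) = 2r + 4k²r³ − 2M. Then: (a) α⁺ satisfies 0 = □α⁺ + (2/r²)Δ′(r)∂ᵣα⁺ + (4/r²)((r²Δ′(r)/(2Δ)) − 2r)∂ₜα⁺ + (4/r²) i (cos ϑ/sin²ϑ)∂_φα⁺ + (2/r²)(1 + 15k²r² − 2cot²ϑ)α⁺ on Ω if and only if 𝔗⁽⁺²⁾α̃⁺ = 0 on Ω; (b) α⁻ satisfies 0 = □α⁻ − (2/r²)Δ′(r)∂ᵣα⁻ − (4/r²)((r²Δ′(r)/(2Δ)) − 2r)∂ₜα⁻ − (4/r²) i (cos ϑ/sin²ϑ)∂_φα⁻ + (2/r²)(−1 + 3k²r²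 − 2cot²ϑ)α⁻ on Ω if and only if 𝔗⁽⁻²⁾α̃⁻ = 0 on Ω. -/
/- Schwarzschild-Anti-de Sitter background: basic operators on functions
   u(t, r, ϑ, φ) with values in ℂ. -/

noncomputable section

open Filter Topology Set

namespace Grav

abbrev F4 : Type := ℝ → ℝ → ℝ → ℝ → ℂ

/-- `Δ(r) = r² + k²r⁴ − 2Mr`. -/
def Del (M k r : ℝ) : ℝ := r ^ 2 + k ^ 2 * r ^ 4 - 2 * M * r

/-- `∂ₜ`. -/
def dT (u : F4) : F4 := fun t r ϑ φ => deriv (fun s => u s r ϑ φ) t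
/-- `∂ᵣ`. -/
def dR (u : F4) : F4 := fun t r ϑ φ => deriv (fun s => u t s ϑ φ) r
/-- `∂_ϑ`. -/
def dTh (u : F4) : F4 := fun t r ϑ φ => deriv (fun s => u t r s φ) ϑ
/-- `∂_φ`. -/
def dPh (u : F4) : F4 := fun t r ϑ φ => deriv (fun s => u t r ϑ s) φ

/-- `L u = ∂ₜ u + (Δ/r²) ∂ᵣ u`. -/
def opL (M k : ℝ) (u : F4) : F4 := fun t r ϑ φ =>
  dT u t r ϑ φ + ((Del M k r / r ^ 2 : ℝ) : ℂ) * dR u t r ϑ φ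

/-- `L̲ u = ∂ₜ u − (Δ/r²) ∂ᵣ u`. -/
def opLb (M k : ℝ) (u : F4) : F4 := fun t r ϑ φ =>
  dT u t r ϑ φ - ((Del M k r / r ^ 2 : ℝ) : ℂ) * dR u t r ϑ φ

/-- `w = Δ/r⁴`. -/
def ww (M k r : ℝ) : ℝ := Del M k r / r ^ 4
/-- `w′ = w·(6M − 2r)/r²`. -/
def wwP (M k r : ℝ) : ℝ := ww M k r * (6 * M - 2 * r) / r ^ 2

/-- The angular operator `𝓛⁽⁺²⁾`. -/
def angP (u : F4) : F4 := fun t r ϑ φ =>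
  -(Real.sin ϑ : ℂ)⁻¹ * deriv (fun x => (Real.sin x : ℂ) * dTh u t r x φ) ϑ
  - (((Real.sin ϑ) ^ 2 : ℝ) : ℂ)⁻¹ * dPh (dPh u) t r ϑ φ
  - 4 * Complex.I * ((Real.cos ϑ / (Real.sin ϑ) ^ 2 : ℝ) : ℂ) * dPh u t r ϑ φ
  + 4 * (((Real.cos ϑ / Real.sin ϑ) ^ 2 : ℝ) : ℂ) * u t r ϑ φ
  + 4 * u t r ϑ φ

/-- The angular operator `𝓛⁽⁻²⁾`. -/
def angM (u : F4) : F4 := fun t r ϑ φ =>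
  -(Real.sin ϑ : ℂ)⁻¹ * deriv (fun x => (Real.sin x : ℂ) * dTh u t r x φ) ϑ
  - (((Real.sin ϑ) ^ 2 : ℝ) : ℂ)⁻¹ * dPh (dPh u) t r ϑ φ
  + 4 * Complex.I * ((Real.cos ϑ / (Real.sin ϑ) ^ 2 : ℝ) : ℂ) * dPh u t r ϑ φ
  + 4 * (((Real.cos ϑ / Real.sin ϑ) ^ 2 : ℝ) : ℂ) * u t r ϑ φ
  + 4 * u t r ϑ φ

/-- The Teukolsky operator `𝔗⁽⁺²⁾u = −LL̲u + 2(w′/w)L̲u − w(𝓛⁽⁺²⁾ − 2 + 6M/r)u`. -/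
def Tp (M k : ℝ) (u : F4) : F4 := fun t r ϑ φ =>
  - opL M k (opLb M k u) t r ϑ φ
  + 2 * ((wwP M k r / ww M k r : ℝ) : ℂ) * opLb M k u t r ϑ φ
  - ((ww M k r : ℝ) : ℂ) *
      (angP u t r ϑ φ - 2 * u t r ϑ φ + ((6 * M / r : ℝ) : ℂ) * u t r ϑ φ)

/-- The Teukolsky operator `𝔗⁽⁻²⁾u = −LL̲u − 2(w′/w)Lu − w(𝓛⁽⁻²⁾ − 2 + 6M/r)u`. -/
def Tm (M k : ℝ) (u : F4) : F4 := fun t r ϑ φ =>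
  - opL M k (opLb M k u) t r ϑ φ
  - 2 * ((wwP M k r / ww M k r : ℝ) : ℂ) * opL M k u t r ϑ φ
  - ((ww M k r : ℝ) : ℂ) *
      (angM u t r ϑ φ - 2 * u t r ϑ φ + ((6 * M / r : ℝ) : ℂ) * u t r ϑ φ)

/-- The Regge–Wheeler operator `𝕽⁽⁺²⁾u = −LL̲u − w(𝓛⁽⁺²⁾ − 6M/r)u`. -/
def RWp (M k : ℝ) (u : F4) : F4 := fun t r ϑ φ =>
  - opL M k (opLb M k u) t r ϑ φ
  - ((ww M k r : ℝ) : ℂ) * (angP u t r ϑ φ - ((6 * M / r : ℝ) : ℂ) * u t r ϑ φ)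

/-- The Regge–Wheeler operator `𝕽⁽⁻²⁾u = −LL̲u − w(𝓛⁽⁻²⁾ − 6M/r)u`. -/
def RWm (M k : ℝ) (u : F4) : F4 := fun t r ϑ φ =>
  - opL M k (opLb M k u) t r ϑ φ
  - ((ww M k r : ℝ) : ℂ) * (angM u t r ϑ φ - ((6 * M / r : ℝ) : ℂ) * u t r ϑ φ)

/-- The exterior region `Ω = {r > r₊, 0 < ϑ < π}` (as a subset of ℝ⁴). -/
def OmSet (rp : ℝ) : Set (ℝ × ℝ × ℝ × ℝ) :=
  {p | rp < p.2.1 ∧ 0 < p.2.2.1 ∧ p.2.2.1 < Real.pi}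

/-- `u` is smooth on `Ω`. -/
def SmoothOnOm (rp : ℝ) (u : F4) : Prop :=
  ContDiffOn ℝ (⊤ : ℕ∞)
    (fun p : ℝ × ℝ × ℝ × ℝ => u p.1 p.2.1 p.2.2.1 p.2.2.2) (OmSet rp)

/-- Multiplication by `w⁻¹`. -/
def winv (M k : ℝ) (u : F4) : F4 := fun t r ϑ φ => ((ww M k r : ℝ) : ℂ)⁻¹ * u t r ϑ φ
/-- Multiplication by `w`. -/
def wmul (M k : ℝ) (u : F4) : F4 := fun t r ϑ φ => ((ww M k r : ℝ) : ℂ) * u t r ϑ φ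
/-- Pointwise complex conjugation. -/
def conjF (u : F4) : F4 := fun t r ϑ φ => (starRingEnd ℂ) (u t r ϑ φ)

/-- `𝓛⁽⁺²⁾(𝓛⁽⁺²⁾ − 2)`. -/
def angSqP (u : F4) : F4 := angP (fun t r ϑ φ => angP u t r ϑ φ - 2 * u t r ϑ φ)
/-- `𝓛⁽⁻²⁾(𝓛⁽⁻²⁾ − 2)`. -/
def angSqM (u : F4) : F4 := angM (fun t r ϑ φ => angM u t r ϑ φ - 2 * u t r ϑ φ)

/-- `𝓛⁽⁺²⁾(𝓛⁽⁺²⁾ − 2) + 12M∂ₜ`. -/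
def TSp (M : ℝ) (u : F4) : F4 := fun t r ϑ φ =>
  angSqP u t r ϑ φ + 12 * (M : ℂ) * dT u t r ϑ φ
/-- `𝓛⁽⁻²⁾(𝓛⁽⁻²⁾ − 2) − 12M∂ₜ`. -/
def TSm (M : ℝ) (u : F4) : F4 := fun t r ϑ φ =>
  angSqM u t r ϑ φ - 12 * (M : ℂ) * dT u t r ϑ φ

/-- The d'Alembertian `□` of the Schwarzschild-AdS metric in `(t,r,ϑ,φ)` coordinates. -/
def BoxOp (M k : ℝ) (u : F4) : F4 := fun t r ϑ φ =>
  -((r ^ 2 / Del M k r : ℝ) : ℂ) * dT (dT u) t r ϑ φ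
  + ((r ^ 2 : ℝ) : ℂ)⁻¹ * deriv (fun s => ((Del M k s : ℝ) : ℂ) * dR u t s ϑ φ) r
  + ((r ^ 2 * Real.sin ϑ : ℝ) : ℂ)⁻¹ * deriv (fun x => (Real.sin x : ℂ) * dTh u t r x φ) ϑ
  + ((r ^ 2 * (Real.sin ϑ) ^ 2 : ℝ) : ℂ)⁻¹ * dPh (dPh u) t r ϑ φ

/-- `Δ′(r) = 2r + 4k²r³ − 2M`. -/
def DelPrime (M k r : ℝ) : ℝ := 2 * r + 4 * k ^ 2 * r ^ 3 - 2 * M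

theorem isOpen_OmSet (rp : ℝ) : IsOpen (OmSet rp) := by
  have hr : IsOpen {p : ℝ × ℝ × ℝ × ℝ | rp < p.2.1} := isOpen_lt (by fun_prop) (by fun_prop)
  have h0 : IsOpen {p : ℝ × ℝ × ℝ × ℝ | 0 < p.2.2.1} := isOpen_lt (by fun_prop) (by fun_prop)
  have hπ : IsOpen {p : ℝ × ℝ × ℝ × ℝ | p.2.2.1 < Real.pi} :=
    isOpen_lt (by fun_prop) (by fun_prop)
  exact hr.inter (h0.inter hπ)

/-- A function of four real variables as a function on `ℝ⁴`. -/
def uncurry4 (u : F4) : ℝ × ℝ × ℝ × ℝ → ℂ := fun p => u p.1 p.2.1 p.2.2.1 p.2.2.2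

theorem SmoothOnOm.contDiffAt {rp : ℝ} {u : F4} (hu : SmoothOnOm rp u)
    {p : ℝ × ℝ × ℝ × ℝ} (hp : p ∈ OmSet rp) : ContDiffAt ℝ (⊤ : ℕ∞) (uncurry4 u) p :=
  ContDiffOn.contDiffAt hu ((isOpen_OmSet rp).mem_nhds hp)

theorem SmoothOnOm.differentiableAt {rp : ℝ} {u : F4} (hu : SmoothOnOm rp u)
    {p : ℝ × ℝ × ℝ × ℝ} (hp : p ∈ OmSet rp) : DifferentiableAt ℝ (uncurry4 u) p :=
  (hu.contDiffAt hp).differentiableAt (by simp)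

theorem SmoothOnOm.hasDerivAt_t_fderiv {rp : ℝ} {u : F4} (hu : SmoothOnOm rp u)
    {t r ϑ φ : ℝ} (hp : (t, r, ϑ, φ) ∈ OmSet rp) :
    HasDerivAt (fun s => u s r ϑ φ) (fderiv ℝ (uncurry4 u) (t, r, ϑ, φ) (1, 0, 0, 0)) t := by
  have hc : HasDerivAt (fun s : ℝ => (s, r, ϑ, φ)) ((1 : ℝ), (0 : ℝ), (0 : ℝ), (0 : ℝ)) t :=
    (hasDerivAt_id t).prodMk (hasDerivAt_const t (r, ϑ, φ))
  exact (hu.differentiableAt hp).hasFDerivAt.comp_hasDerivAt t hc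

theorem SmoothOnOm.hasDerivAt_r_fderiv {rp : ℝ} {u : F4} (hu : SmoothOnOm rp u)
    {t r ϑ φ : ℝ} (hp : (t, r, ϑ, φ) ∈ OmSet rp) :
    HasDerivAt (fun s => u t s ϑ φ) (fderiv ℝ (uncurry4 u) (t, r, ϑ, φ) (0, 1, 0, 0)) r := by
  have hc : HasDerivAt (fun s : ℝ => (t, s, ϑ, φ)) ((0 : ℝ), (1 : ℝ), (0 : ℝ), (0 : ℝ)) r :=
    (hasDerivAt_const r t).prodMk ((hasDerivAt_id r).prodMk (hasDerivAt_const r (ϑ, φ)))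
  exact (hu.differentiableAt hp).hasFDerivAt.comp_hasDerivAt r hc

theorem SmoothOnOm.dT_eq_fderiv {rp : ℝ} {u : F4} (hu : SmoothOnOm rp u)
    {p : ℝ × ℝ × ℝ × ℝ} (hp : p ∈ OmSet rp) :
    uncurry4 (dT u) p = fderiv ℝ (uncurry4 u) p (1, 0, 0, 0) :=
  (hu.hasDerivAt_t_fderiv hp).deriv

theorem SmoothOnOm.dR_eq_fderiv {rp : ℝ} {u : F4} (hu : SmoothOnOm rp u)
    {p : ℝ × ℝ × ℝ × ℝ} (hp : p ∈ OmSet rp) :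
    uncurry4 (dR u) p = fderiv ℝ (uncurry4 u) p (0, 1, 0, 0) :=
  (hu.hasDerivAt_r_fderiv hp).deriv

theorem SmoothOnOm.contDiffOn_fderiv {rp : ℝ} {u : F4} (hu : SmoothOnOm rp u) :
    ContDiffOn ℝ (⊤ : ℕ∞) (fderiv ℝ (uncurry4 u)) (OmSet rp) :=
  ContDiffOn.fderiv_of_isOpen hu (isOpen_OmSet rp) (by simp)

theorem SmoothOnOm.dT {rp : ℝ} {u : F4} (hu : SmoothOnOm rp u) : SmoothOnOm rp (dT u) :=
  (hu.contDiffOn_fderiv.clm_apply contDiffOn_const).congr fun _ hp => hu.dT_eq_fderiv hp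

theorem SmoothOnOm.dR {rp : ℝ} {u : F4} (hu : SmoothOnOm rp u) : SmoothOnOm rp (dR u) :=
  (hu.contDiffOn_fderiv.clm_apply contDiffOn_const).congr fun _ hp => hu.dR_eq_fderiv hp

theorem SmoothOnOm.hasDerivAt_t {rp : ℝ} {u : F4} (hu : SmoothOnOm rp u)
    {t r ϑ φ : ℝ} (hp : (t, r, ϑ, φ) ∈ OmSet rp) :
    HasDerivAt (fun s => u s r ϑ φ) (Grav.dT u t r ϑ φ) t :=
  (hu.hasDerivAt_t_fderiv hp).differentiableAt.hasDerivAt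

theorem SmoothOnOm.hasDerivAt_r {rp : ℝ} {u : F4} (hu : SmoothOnOm rp u)
    {t r ϑ φ : ℝ} (hp : (t, r, ϑ, φ) ∈ OmSet rp) :
    HasDerivAt (fun s => u t s ϑ φ) (Grav.dR u t r ϑ φ) r :=
  (hu.hasDerivAt_r_fderiv hp).differentiableAt.hasDerivAt

/-- The partial derivatives `∂ₜ` and `∂ᵣ` of a smooth function commute. -/
theorem SmoothOnOm.dT_dR_comm {rp : ℝ} {u : F4} (hu : SmoothOnOm rp u)
    {t r ϑ φ : ℝ} (hp : (t, r, ϑ, φ) ∈ OmSet rp) :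
    Grav.dT (Grav.dR u) t r ϑ φ = Grav.dR (Grav.dT u) t r ϑ φ := by
  have hmem := (isOpen_OmSet rp).mem_nhds hp
  have hd : DifferentiableAt ℝ (fderiv ℝ (uncurry4 u)) (t, r, ϑ, φ) :=
    (hu.contDiffOn_fderiv.contDiffAt hmem).differentiableAt (by simp)
  have hR : uncurry4 (Grav.dR u) =ᶠ[𝓝 (t, r, ϑ, φ)]
      fun q => fderiv ℝ (uncurry4 u) q (0, 1, 0, 0) :=
    Filter.eventually_of_mem hmem fun _ hq => hu.dR_eq_fderiv hq
  have hT : uncurry4 (Grav.dT u) =ᶠ[𝓝 (t, r, ϑ, φ)]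
      fun q => fderiv ℝ (uncurry4 u) q (1, 0, 0, 0) :=
    Filter.eventually_of_mem hmem fun _ hq => hu.dT_eq_fderiv hq
  have hsymm : IsSymmSndFDerivAt ℝ (uncurry4 u) (t, r, ϑ, φ) :=
    (hu.contDiffAt hp).isSymmSndFDerivAt
      (by simpa using WithTop.coe_le_coe.mpr (le_top : (2 : ℕ∞) ≤ ⊤))
  have h1 := hu.dR.dT_eq_fderiv hp
  have h2 := hu.dT.dR_eq_fderiv hp
  rw [hR.fderiv_eq, fderiv_clm_apply hd (differentiableAt_const _)] at h1
  rw [hT.fderiv_eq, fderiv_clm_apply hd (differentiableAt_const _)] at h2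
  simp only [fderiv_fun_const, Pi.zero_apply, ContinuousLinearMap.comp_zero, zero_add,
    ContinuousLinearMap.flip_apply] at h1 h2
  exact h1.trans ((hsymm _ _).trans h2.symm)

theorem hasDerivAt_Del (M k r : ℝ) : HasDerivAt (Del M k) (DelPrime M k r) r := by
  have h := (((hasDerivAt_id r).pow 2).add (((hasDerivAt_id r).pow 4).const_mul (k ^ 2))).sub
    ((hasDerivAt_id r).const_mul (2 * M))
  refine h.congr_deriv ?_
  simp only [DelPrime, id]
  push_cast
  ring

theorem hasDerivAt_DelPrime (M k r : ℝ) :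
    HasDerivAt (DelPrime M k) (2 + 12 * k ^ 2 * r ^ 2) r := by
  have h := (((hasDerivAt_id r).const_mul 2).add
    (((hasDerivAt_id r).pow 3).const_mul (4 * k ^ 2))).sub_const (2 * M)
  refine h.congr_deriv ?_
  simp only [id]
  push_cast
  ring

theorem Del_pos {M k rp r : ℝ} (hrp : 0 < rp) (hroot : rp + k ^ 2 * rp ^ 3 - 2 * M = 0)
    (hr : rp < r) : 0 < Del M k r := by
  have h3 : rp ^ 3 ≤ r ^ 3 := pow_le_pow_left₀ hrp.le hr.le 3
  have h : 0 < r + k ^ 2 * r ^ 3 - 2 * M := by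
    nlinarith [mul_le_mul_of_nonneg_left h3 (sq_nonneg k)]
  have := mul_pos (hrp.trans hr) h
  unfold Del
  linarith

theorem contDiff_Del (M k : ℝ) : ContDiff ℝ (⊤ : ℕ∞) (Del M k) := by
  unfold Del
  fun_prop

/-- Expansion of the wave operator `L L̲` on smooth functions. -/
theorem SmoothOnOm.opL_opLb {M k rp : ℝ} (hrp : 0 < rp) {u : F4} (hu : SmoothOnOm rp u)
    {t r ϑ φ : ℝ} (hp : (t, r, ϑ, φ) ∈ OmSet rp) :
    opL M k (opLb M k u) t r ϑ φ = Grav.dT (Grav.dT u) t r ϑ φ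
      - ((Del M k r / r ^ 2 : ℝ) : ℂ) *
        (((DelPrime M k r / r ^ 2 - 2 * Del M k r / r ^ 3 : ℝ) : ℂ) * Grav.dR u t r ϑ φ
          + ((Del M k r / r ^ 2 : ℝ) : ℂ) * Grav.dR (Grav.dR u) t r ϑ φ) := by
  have hr : r ≠ 0 := (hrp.trans hp.1).ne'
  have ha : HasDerivAt (fun s => Del M k s / s ^ 2)
      (DelPrime M k r / r ^ 2 - 2 * Del M k r / r ^ 3) r := by
    refine ((hasDerivAt_Del M k r).div ((hasDerivAt_id r).pow 2) (by simpa using hr)).congr_deriv ?_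
    simp only [id, Pi.pow_apply]
    field_simp
    push_cast
    ring
  have h1 : Grav.dT (opLb M k u) t r ϑ φ = Grav.dT (Grav.dT u) t r ϑ φ
      - ((Del M k r / r ^ 2 : ℝ) : ℂ) * Grav.dT (Grav.dR u) t r ϑ φ :=
    ((hu.dT.hasDerivAt_t hp).sub ((hu.dR.hasDerivAt_t hp).const_mul _)).deriv
  have h2 : Grav.dR (opLb M k u) t r ϑ φ = Grav.dR (Grav.dT u) t r ϑ φ
      - (((DelPrime M k r / r ^ 2 - 2 * Del M k r / r ^ 3 : ℝ) : ℂ) * Grav.dR u t r ϑ φ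
          + ((Del M k r / r ^ 2 : ℝ) : ℂ) * Grav.dR (Grav.dR u) t r ϑ φ) :=
    ((hu.dT.hasDerivAt_r hp).sub (ha.ofReal_comp.mul (hu.dR.hasDerivAt_r hp))).deriv
  unfold opL
  rw [h1, h2, hu.dT_dR_comm hp]
  ring

/-- Multiplication by a real radial weight. -/
def radialMul (g : ℝ → ℝ) (u : F4) : F4 := fun t r ϑ φ => ((g r : ℝ) : ℂ) * u t r ϑ φ

theorem SmoothOnOm.radialMul {rp : ℝ} {u : F4} (hu : SmoothOnOm rp u) {g : ℝ → ℝ}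
    (hg : ContDiffOn ℝ (⊤ : ℕ∞) g (Ioi rp)) : SmoothOnOm rp (radialMul g u) := by
  have h : ContDiffOn ℝ (⊤ : ℕ∞) (fun p : ℝ × ℝ × ℝ × ℝ => g p.2.1) (OmSet rp) :=
    hg.comp (by fun_prop) fun _ hp => hp.1
  exact (Complex.ofRealCLM.contDiff.comp_contDiffOn h).mul hu

theorem dT_radialMul (g : ℝ → ℝ) (u : F4) : dT (radialMul g u) = radialMul g (dT u) := by
  funext t r ϑ φ
  exact deriv_const_mul_field _

theorem dTh_radialMul (g : ℝ → ℝ) (u : F4) : dTh (radialMul g u) = radialMul g (dTh u) := by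
  funext t r ϑ φ
  exact deriv_const_mul_field _

theorem dPh_radialMul (g : ℝ → ℝ) (u : F4) : dPh (radialMul g u) = radialMul g (dPh u) := by
  funext t r ϑ φ
  exact deriv_const_mul_field _

theorem deriv_sin_mul_radialMul (g : ℝ → ℝ) (u : F4) (t r ϑ φ : ℝ) :
    deriv (fun x => (Real.sin x : ℂ) * radialMul g u t r x φ) ϑ
      = (g r : ℂ) * deriv (fun x => (Real.sin x : ℂ) * u t r x φ) ϑ := by
  rw [← deriv_const_mul_field]
  congr 1
  funext x
  simp only [radialMul]
  ring

theorem angP_radialMul (g : ℝ → ℝ) (u : F4) : angP (radialMul g u) = radialMul g (angP u) := by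
  funext t r ϑ φ
  simp only [angP, dTh_radialMul, dPh_radialMul, deriv_sin_mul_radialMul]
  simp only [radialMul, angP]
  ring

theorem angM_radialMul (g : ℝ → ℝ) (u : F4) : angM (radialMul g u) = radialMul g (angM u) := by
  funext t r ϑ φ
  simp only [angM, dTh_radialMul, dPh_radialMul, deriv_sin_mul_radialMul]
  simp only [radialMul, angM]
  ring

theorem SmoothOnOm.dR_radialMul {rp : ℝ} {u : F4} (hu : SmoothOnOm rp u) {g g₁ : ℝ → ℝ}
    (hg : ∀ r, rp < r → HasDerivAt g (g₁ r) r) {t r ϑ φ : ℝ} (hp : (t, r, ϑ, φ) ∈ OmSet rp) :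
    Grav.dR (Grav.radialMul g u) t r ϑ φ
      = (g₁ r : ℂ) * u t r ϑ φ + (g r : ℂ) * Grav.dR u t r ϑ φ :=
  ((hg r hp.1).ofReal_comp.mul (hu.hasDerivAt_r hp)).deriv

theorem SmoothOnOm.dR_dR_radialMul {rp : ℝ} {u : F4} (hu : SmoothOnOm rp u) {g g₁ g₂ : ℝ → ℝ}
    (hg : ∀ r, rp < r → HasDerivAt g (g₁ r) r) (hg₁ : ∀ r, rp < r → HasDerivAt g₁ (g₂ r) r)
    {t r ϑ φ : ℝ} (hp : (t, r, ϑ, φ) ∈ OmSet rp) :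
    Grav.dR (Grav.dR (Grav.radialMul g u)) t r ϑ φ
      = (g₂ r : ℂ) * u t r ϑ φ + 2 * (g₁ r : ℂ) * Grav.dR u t r ϑ φ
        + (g r : ℂ) * Grav.dR (Grav.dR u) t r ϑ φ := by
  have hev : (fun s => Grav.dR (Grav.radialMul g u) t s ϑ φ) =ᶠ[𝓝 r]
      fun s => (g₁ s : ℂ) * u t s ϑ φ + (g s : ℂ) * Grav.dR u t s ϑ φ :=
    Filter.eventually_of_mem (Ioi_mem_nhds hp.1) fun s hs =>
      hu.dR_radialMul hg (show (t, s, ϑ, φ) ∈ OmSet rp from ⟨hs, hp.2⟩)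
  have h := ((hg₁ r hp.1).ofReal_comp.mul (hu.hasDerivAt_r hp)).add
    ((hg r hp.1).ofReal_comp.mul (hu.dR.hasDerivAt_r hp))
  refine hev.deriv_eq.trans (h.deriv.trans ?_)
  ring

theorem SmoothOnOm.deriv_Del_mul_dR {M k rp : ℝ} {u : F4} (hu : SmoothOnOm rp u)
    {t r ϑ φ : ℝ} (hp : (t, r, ϑ, φ) ∈ OmSet rp) :
    deriv (fun s => ((Del M k s : ℝ) : ℂ) * Grav.dR u t s ϑ φ) r
      = (DelPrime M k r : ℂ) * Grav.dR u t r ϑ φ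
        + (Del M k r : ℂ) * Grav.dR (Grav.dR u) t r ϑ φ :=
  ((hasDerivAt_Del M k r).ofReal_comp.mul (hu.dR.hasDerivAt_r hp)).deriv

/-- The weight `Δ²r⁻³` intertwines the spin `+2` Teukolsky operators. -/
theorem SmoothOnOm.Tp_radialMul {M k rp : ℝ} (hrp : 0 < rp)
    (hroot : rp + k ^ 2 * rp ^ 3 - 2 * M = 0) {u : F4} (hu : SmoothOnOm rp u)
    {t r ϑ φ : ℝ} (hp : (t, r, ϑ, φ) ∈ OmSet rp) :
    Tp M k (Grav.radialMul (fun r => (Del M k r) ^ 2 / r ^ 3) u) t r ϑ φ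
      = ((Del M k r ^ 3 / r ^ 5 : ℝ) : ℂ) * (BoxOp M k u t r ϑ φ
          + ((2 / r ^ 2 : ℝ) : ℂ) * ((DelPrime M k r : ℝ) : ℂ) * Grav.dR u t r ϑ φ
          + ((4 / r ^ 2 : ℝ) : ℂ) *
              ((r ^ 2 * DelPrime M k r / (2 * Del M k r) - 2 * r : ℝ) : ℂ) * Grav.dT u t r ϑ φ
          + ((4 / r ^ 2 : ℝ) : ℂ) * Complex.I *
              ((Real.cos ϑ / (Real.sin ϑ) ^ 2 : ℝ) : ℂ) * dPh u t r ϑ φ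
          + ((2 / r ^ 2 : ℝ) : ℂ) *
              ((1 + 15 * k ^ 2 * r ^ 2 - 2 * (Real.cos ϑ / Real.sin ϑ) ^ 2 : ℝ) : ℂ) *
                u t r ϑ φ) := by
  have hr0 : ∀ s, rp < s → s ≠ 0 := fun s hs => (hrp.trans hs).ne'
  have hg : ∀ s, rp < s → HasDerivAt (fun r => (Del M k r) ^ 2 / r ^ 3)
      (2 * Del M k s * DelPrime M k s / s ^ 3 - 3 * Del M k s ^ 2 / s ^ 4) s := by
    intro s hs
    have hs0 := hr0 s hs
    refine (((hasDerivAt_Del M k s).pow 2).div ((hasDerivAt_id s).pow 3)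
      (by simpa using hs0)).congr_deriv ?_
    simp only [id, Pi.pow_apply]
    field_simp
    push_cast
    ring
  have hg₁ : ∀ s, rp < s → HasDerivAt
      (fun s => 2 * Del M k s * DelPrime M k s / s ^ 3 - 3 * Del M k s ^ 2 / s ^ 4)
      (2 * DelPrime M k s ^ 2 / s ^ 3 + 2 * Del M k s * (2 + 12 * k ^ 2 * s ^ 2) / s ^ 3
        - 12 * Del M k s * DelPrime M k s / s ^ 4 + 12 * Del M k s ^ 2 / s ^ 5) s := by
    intro s hs
    have hs0 := hr0 s hs
    refine (((((hasDerivAt_Del M k s).const_mul 2).mul (hasDerivAt_DelPrime M k s)).div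
      ((hasDerivAt_id s).pow 3) (by simpa using hs0)).sub
      ((((hasDerivAt_Del M k s).pow 2).const_mul 3).div ((hasDerivAt_id s).pow 4)
      (by simpa using hs0))).congr_deriv ?_
    simp only [id, Pi.pow_apply, Pi.mul_apply]
    field_simp
    push_cast
    ring
  have hgs : ContDiffOn ℝ (⊤ : ℕ∞) (fun r => (Del M k r) ^ 2 / r ^ 3) (Ioi rp) :=
    ((contDiff_Del M k).pow 2).contDiffOn.div (by fun_prop) fun s hs => pow_ne_zero 3 (hr0 s hs)
  have hr := hr0 r hp.1
  have hD : Del M k r ≠ 0 := (Del_pos hrp hroot hp.1).ne'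
  have hsin : Real.sin ϑ ≠ 0 := (Real.sin_pos_of_pos_of_lt_pi hp.2.1 hp.2.2).ne'
  rw [Tp, (hu.radialMul hgs).opL_opLb hrp hp, opLb, dT_radialMul, dT_radialMul,
    hu.dR_radialMul hg hp, hu.dR_dR_radialMul hg hg₁ hp, angP_radialMul, BoxOp,
    hu.deriv_Del_mul_dR hp]
  simp only [Grav.radialMul, angP, wwP, ww]
  have hrC : (r : ℂ) ≠ 0 := by exact_mod_cast hr
  have hDC : (Del M k r : ℂ) ≠ 0 := by exact_mod_cast hD
  have hsC : (Real.sin ϑ : ℂ) ≠ 0 := by exact_mod_cast hsin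
  have hM' : (M : ℂ) = (r ^ 2 + k ^ 2 * r ^ 4 - Del M k r) / (2 * r) := by
    rw [eq_div_iff (by simpa using hr)]
    simp only [Del]
    push_cast
    ring
  have hDP : (DelPrime M k r : ℂ) = 2 * r + 4 * k ^ 2 * r ^ 3 - 2 * M := by
    simp only [DelPrime]
    push_cast
    ring
  push_cast at hsC ⊢
  rw [hDP, hM']
  field_simp
  ring

/-- The weight `r⁻³` intertwines the spin `-2` Teukolsky operators. -/
theorem SmoothOnOm.Tm_radialMul {M k rp : ℝ} (hrp : 0 < rp)
    (hroot : rp + k ^ 2 * rp ^ 3 - 2 * M = 0) {u : F4} (hu : SmoothOnOm rp u)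
    {t r ϑ φ : ℝ} (hp : (t, r, ϑ, φ) ∈ OmSet rp) :
    Tm M k (Grav.radialMul (fun r => (r ^ 3)⁻¹) u) t r ϑ φ
      = ((Del M k r / r ^ 5 : ℝ) : ℂ) * (BoxOp M k u t r ϑ φ
          - ((2 / r ^ 2 : ℝ) : ℂ) * ((DelPrime M k r : ℝ) : ℂ) * Grav.dR u t r ϑ φ
          - ((4 / r ^ 2 : ℝ) : ℂ) *
              ((r ^ 2 * DelPrime M k r / (2 * Del M k r) - 2 * r : ℝ) : ℂ) * Grav.dT u t r ϑ φ
          - ((4 / r ^ 2 : ℝ) : ℂ) * Complex.I *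
              ((Real.cos ϑ / (Real.sin ϑ) ^ 2 : ℝ) : ℂ) * dPh u t r ϑ φ
          + ((2 / r ^ 2 : ℝ) : ℂ) *
              ((-1 + 3 * k ^ 2 * r ^ 2 - 2 * (Real.cos ϑ / Real.sin ϑ) ^ 2 : ℝ) : ℂ) *
                u t r ϑ φ) := by
  have hr0 : ∀ s, rp < s → s ≠ 0 := fun s hs => (hrp.trans hs).ne'
  have hg : ∀ s, rp < s → HasDerivAt (fun r : ℝ => (r ^ 3)⁻¹) (-3 * (s ^ 4)⁻¹) s := by
    intro s hs
    have hs0 := hr0 s hs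
    refine (((hasDerivAt_id s).pow 3).inv (by simpa using hs0)).congr_deriv ?_
    simp only [id, Pi.pow_apply]
    field_simp
    push_cast
    ring
  have hg₁ : ∀ s, rp < s → HasDerivAt (fun s : ℝ => -3 * (s ^ 4)⁻¹) (12 * (s ^ 5)⁻¹) s := by
    intro s hs
    have hs0 := hr0 s hs
    refine ((((hasDerivAt_id s).pow 4).inv (by simpa using hs0)).const_mul (-3)).congr_deriv ?_
    simp only [id, Pi.pow_apply]
    field_simp
    push_cast
    ring
  have hgs : ContDiffOn ℝ (⊤ : ℕ∞) (fun r : ℝ => (r ^ 3)⁻¹) (Ioi rp) :=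
    ContDiffOn.inv (by fun_prop) fun s hs => pow_ne_zero 3 (hr0 s hs)
  have hr := hr0 r hp.1
  have hD : Del M k r ≠ 0 := (Del_pos hrp hroot hp.1).ne'
  have hsin : Real.sin ϑ ≠ 0 := (Real.sin_pos_of_pos_of_lt_pi hp.2.1 hp.2.2).ne'
  rw [Tm, (hu.radialMul hgs).opL_opLb hrp hp, opL, dT_radialMul, dT_radialMul,
    hu.dR_radialMul hg hp, hu.dR_dR_radialMul hg hg₁ hp, angM_radialMul, BoxOp,
    hu.deriv_Del_mul_dR hp]
  simp only [Grav.radialMul, angM, wwP, ww]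
  have hrC : (r : ℂ) ≠ 0 := by exact_mod_cast hr
  have hDC : (Del M k r : ℂ) ≠ 0 := by exact_mod_cast hD
  have hsC : (Real.sin ϑ : ℂ) ≠ 0 := by exact_mod_cast hsin
  have hM' : (M : ℂ) = (r ^ 2 + k ^ 2 * r ^ 4 - Del M k r) / (2 * r) := by
    rw [eq_div_iff (by simpa using hr)]
    simp only [Del]
    push_cast
    ring
  have hDP : (DelPrime M k r : ℂ) = 2 * r + 4 * k ^ 2 * r ^ 3 - 2 * M := by
    simp only [DelPrime]
    push_cast
    ring
  push_cast at hsC ⊢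
  rw [hDP, hM']
  field_simp
  ring

/-- The original spin `±2` Teukolsky equations are equivalent to the
rescaled Teukolsky equations `𝔗⁽±²⁾α̃⁽±²⁾ = 0` for `α̃⁺ = Δ²r⁻³α⁺`, `α̃⁻ = r⁻³α⁻`. -/
theorem statement0
    (M k rp : ℝ) (hM : 0 < M) (hk : 0 < k) (hrp : 0 < rp)
    (hroot : rp + k ^ 2 * rp ^ 3 - 2 * M = 0)
    (αp αm : F4) (hαp : SmoothOnOm rp αp) (hαm : SmoothOnOm rp αm) :
    ((∀ t r ϑ φ : ℝ, (t, r, ϑ, φ) ∈ OmSet rp →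
        (0 : ℂ) = BoxOp M k αp t r ϑ φ
          + ((2 / r ^ 2 : ℝ) : ℂ) * ((DelPrime M k r : ℝ) : ℂ) * dR αp t r ϑ φ
          + ((4 / r ^ 2 : ℝ) : ℂ) *
              ((r ^ 2 * DelPrime M k r / (2 * Del M k r) - 2 * r : ℝ) : ℂ) * dT αp t r ϑ φ
          + ((4 / r ^ 2 : ℝ) : ℂ) * Complex.I *
              ((Real.cos ϑ / (Real.sin ϑ) ^ 2 : ℝ) : ℂ) * dPh αp t r ϑ φ
          + ((2 / r ^ 2 : ℝ) : ℂ) *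
              ((1 + 15 * k ^ 2 * r ^ 2 - 2 * (Real.cos ϑ / Real.sin ϑ) ^ 2 : ℝ) : ℂ) *
                αp t r ϑ φ)
      ↔ (∀ t r ϑ φ : ℝ, (t, r, ϑ, φ) ∈ OmSet rp →
          Tp M k (fun t r ϑ φ => (((Del M k r) ^ 2 / r ^ 3 : ℝ) : ℂ) * αp t r ϑ φ)
            t r ϑ φ = 0))
    ∧
    ((∀ t r ϑ φ : ℝ, (t, r, ϑ, φ) ∈ OmSet rp →
        (0 : ℂ) = BoxOp M k αm t r ϑ φ
          - ((2 / r ^ 2 : ℝ) : ℂ) * ((DelPrime M k r : ℝ) : ℂ) * dR αm t r ϑ φ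
          - ((4 / r ^ 2 : ℝ) : ℂ) *
              ((r ^ 2 * DelPrime M k r / (2 * Del M k r) - 2 * r : ℝ) : ℂ) * dT αm t r ϑ φ
          - ((4 / r ^ 2 : ℝ) : ℂ) * Complex.I *
              ((Real.cos ϑ / (Real.sin ϑ) ^ 2 : ℝ) : ℂ) * dPh αm t r ϑ φ
          + ((2 / r ^ 2 : ℝ) : ℂ) *
              ((-1 + 3 * k ^ 2 * r ^ 2 - 2 * (Real.cos ϑ / Real.sin ϑ) ^ 2 : ℝ) : ℂ) *
                αm t r ϑ φ)
      ↔ (∀ t r ϑ φ : ℝ, (t, r, ϑ, φ) ∈ OmSet rp →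
          Tm M k (fun t r ϑ φ => ((r ^ 3 : ℝ) : ℂ)⁻¹ * αm t r ϑ φ) t r ϑ φ = 0)) := by
  have hfactor : ∀ {r : ℝ}, rp < r → ∀ n : ℕ, ((Del M k r ^ n / r ^ 5 : ℝ) : ℂ) ≠ 0 :=
    fun hr n => Complex.ofReal_ne_zero.mpr (div_pos (pow_pos (Del_pos hrp hroot hr) n)
      (pow_pos (hrp.trans hr) 5)).ne'
  constructor
  · refine forall₄_congr fun t r ϑ φ => forall_congr' fun hp => ?_
    have h := hαp.Tp_radialMul hrp hroot hp
    unfold radialMul at h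
    rw [h, mul_eq_zero, or_iff_right (hfactor hp.1 3), eq_comm]
  · refine forall₄_congr fun t r ϑ φ => forall_congr' fun hp => ?_
    have h := hαm.Tm_radialMul hrp hroot hp
    unfold radialMul at h
    simp only [Complex.ofReal_inv] at h
    rw [h, mul_eq_zero, or_iff_right (by simpa using hfactor hp.1 1), eq_comm]

end Grav
end
end

section
/- Let α̃⁽⁺²⁾, α̃⁽⁻²⁾ be smooth on Ω with 𝔗⁽±²⁾α̃⁽±²⁾ = 0, and define ψ⁽⁺²⁾ = w⁻¹L̲α̃⁽⁺²⁾, Ψ⁽⁺²⁾ = w⁻¹L̲ψ⁽⁺²⁾, ψ⁽⁻²⁾ = w⁻¹Lα̃⁽⁻²⁾, Ψ⁽⁻²⁾ = w⁻¹Lψ⁽⁻²⁾. Let 𝒟 be the set of operators P = ∂ₜʲ∘(𝓛⁽⁺²⁾)ⁿ with 0≤j≤3 and 0≤n≤2. Assume: (H1) for each q in { α̃⁽⁺²⁾, (α̃⁽⁻²⁾)*, ψ⁽⁺²⁾, (ψ⁽⁻²⁾)*, Ψ⁽⁺²⁾, (Ψ⁽⁻²⁾)* } and each P∈𝒟, the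 functions Pq, PLq and PL̲q converge at infinity to limits that are smooth in (t,ϑ,φ), and these limits commute with ∂ₜ, ∂_ϑ, ∂_φ (the limit of the derivative equals the derivative of the limit); (H2) for each P∈𝒟, P(α̃⁽⁺²⁾ − (α̃⁽⁻²⁾)*) → 0 and P( r²∂ᵣα̃⁽⁺²⁾ + r²∂ᵣ(α̃⁽⁻²⁾)* ) → 0 at infinity (the conformal Teukolsky boundary conditions and their derivatives). Then, writing 𝓛 = 𝓛⁽⁺²⁾: (i) ψ⁽⁺²⁾ − (ψ⁽⁻²⁾)* → 0 and r²∂ᵣψ⁽⁺²⁾ + r²∂ᵣ(ψ⁽⁻²⁾)* → 0 at infinity; (ii) Ψ⁽⁺²⁾ − (Ψ⁽⁻²⁾)* → 0 at infinity; (iii) LLΨ⁽⁺²⁾ + L̲L̲(Ψ⁽⁻²⁾)* + (1/(6M))𝓛(𝓛−2)( LΨ⁽⁺²⁾ − L̲(Ψ⁽⁻²⁾)* ) → 0 at infinity. -/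
/- Schwarzschild-Anti-de Sitter background: basic operators on functions
   u(t, r, ϑ, φ) with values in ℂ. -/

noncomputable section

open Filter Topology Set

namespace Grav

/-- `q → 0` at infinity: for every fixed `(t,ϑ,φ)` with `ϑ ∈ (0,π)`,
`q(t,r,ϑ,φ) → 0` as `r → +∞`. -/
def tends0 (q : F4) : Prop :=
  ∀ t φ : ℝ, ∀ ϑ ∈ Set.Ioo (0 : ℝ) Real.pi,
    Tendsto (fun r => q t r ϑ φ) atTop (𝓝 (0 : ℂ))

/-- `q` converges at infinity to a limit which is smooth in `(t,ϑ,φ)` and which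
commutes with `∂ₜ`, `∂_ϑ`, `∂_φ` (the limit of the derivative equals the derivative
of the limit). -/
def Nice (q : F4) : Prop :=
  ∃ q0 : ℝ → ℝ → ℝ → ℂ,
    ContDiffOn ℝ (⊤ : ℕ∞) (fun p : ℝ × ℝ × ℝ => q0 p.1 p.2.1 p.2.2)
      {p : ℝ × ℝ × ℝ | 0 < p.2.1 ∧ p.2.1 < Real.pi} ∧
    ∀ t φ : ℝ, ∀ ϑ ∈ Set.Ioo (0 : ℝ) Real.pi,
      Tendsto (fun r => q t r ϑ φ) atTop (𝓝 (q0 t ϑ φ)) ∧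
      Tendsto (fun r => dT q t r ϑ φ) atTop (𝓝 (deriv (fun s => q0 s ϑ φ) t)) ∧
      Tendsto (fun r => dTh q t r ϑ φ) atTop (𝓝 (deriv (fun s => q0 t s φ) ϑ)) ∧
      Tendsto (fun r => dPh q t r ϑ φ) atTop (𝓝 (deriv (fun s => q0 t ϑ s) φ))

/-- A sequence of functions which is continuous and pointwise bounded above on a nonempty open
subset of a Baire space is uniformly bounded above on a smaller nonempty open set. -/
theorem exists_isOpen_uniform_bound {X : Type*} [TopologicalSpace X] [BaireSpace X]
    {N : ℕ → X → ℝ} {W : Set X} (hW : IsOpen W) (hne : W.Nonempty)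
    (hN : ∀ n, ContinuousOn (N n) W) (hb : ∀ p ∈ W, ∃ C, ∀ n, N n p ≤ C) :
    ∃ O ⊆ W, IsOpen O ∧ O.Nonempty ∧ ∃ C, ∀ n, ∀ p ∈ O, N n p ≤ C := by
  let f : ℕ → Set X := fun m => (⋃ n, W ∩ N n ⁻¹' Ioi (m : ℝ))ᶜ
  have hf : ∀ m, IsClosed (f m) := fun m =>
    (isOpen_iUnion fun n => (hN n).isOpen_inter_preimage hW isOpen_Ioi).isClosed_compl
  have hU : ⋃ m, f m = univ := by
    refine eq_univ_of_forall fun p => mem_iUnion.2 ?_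
    by_cases hp : p ∈ W
    · obtain ⟨C, hC⟩ := hb p hp
      obtain ⟨m, hm⟩ := exists_nat_ge C
      refine ⟨m, fun h => ?_⟩
      obtain ⟨n, hn⟩ := mem_iUnion.1 h
      exact absurd hn.2 (not_lt.2 ((hC n).trans hm))
    · refine ⟨0, fun h => ?_⟩
      obtain ⟨n, hn⟩ := mem_iUnion.1 h
      exact hp hn.1
  obtain ⟨p, hpW, hp⟩ := (dense_iUnion_interior_of_closed hf hU).inter_open_nonempty W hW hne
  obtain ⟨m, hm⟩ := mem_iUnion.1 hp
  refine ⟨W ∩ interior (f m), inter_subset_left, hW.inter isOpen_interior, ⟨p, hpW, hm⟩, m,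
    fun n q hq => ?_⟩
  by_contra h
  exact interior_subset hq.2 (mem_iUnion.2 ⟨n, hq.1, not_le.1 h⟩)

/-- Pointwise, locally bounded convergence to zero of functions on an interval. -/
theorem tendsto_intervalIntegral_zero {g : ℕ → ℝ → ℂ} {a b C : ℝ} (hab : a ≤ b)
    (hc : ∀ n, ContinuousOn (g n) (Icc a b)) (hb : ∀ n, ∀ x ∈ Icc a b, ‖g n x‖ ≤ C)
    (hl : ∀ x ∈ Icc a b, Tendsto (fun n => g n x) atTop (𝓝 0)) :
    Tendsto (fun n => ∫ x in a..b, g n x) atTop (𝓝 0) := by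
  have hsub : Set.uIoc a b ⊆ Icc a b := by
    rw [uIoc_of_le hab]; exact Ioc_subset_Icc_self
  have := intervalIntegral.tendsto_integral_filter_of_dominated_convergence (μ := MeasureTheory.volume)
    (a := a) (b := b) (F := g) (f := fun _ => (0 : ℂ)) (l := atTop) (fun _ => C)
    (Eventually.of_forall fun n =>
      ((hc n).mono hsub).aestronglyMeasurable measurableSet_uIoc)
    (Eventually.of_forall fun n => Eventually.of_forall fun x hx => hb n x (hsub hx))
    intervalIntegrable_const
    (Eventually.of_forall fun x hx => hl x (hsub hx))
  simpa using this

/-- If planar vector fields `(P n, Q n)` converge pointwise to zero and their divergences converge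
pointwise to a continuous function, then that function vanishes. -/
theorem eq_zero_of_tendsto_divergence {V : Set (ℝ × ℝ)} (hV : IsOpen V)
    {P Q : ℕ → ℝ × ℝ → ℂ} {h : ℝ × ℝ → ℂ}
    (hP : ∀ n, ∀ p ∈ V, DifferentiableAt ℝ (P n) p)
    (hQ : ∀ n, ∀ p ∈ V, DifferentiableAt ℝ (Q n) p)
    (hc : ∀ n, ContinuousOn (fun p => fderiv ℝ (P n) p (1, 0) + fderiv ℝ (Q n) p (0, 1)) V)
    (hP0 : ∀ p ∈ V, Tendsto (fun n => P n p) atTop (𝓝 0))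
    (hQ0 : ∀ p ∈ V, Tendsto (fun n => Q n p) atTop (𝓝 0))
    (hh : ∀ p ∈ V, Tendsto (fun n => fderiv ℝ (P n) p (1, 0) + fderiv ℝ (Q n) p (0, 1))
      atTop (𝓝 (h p)))
    (hcont : ContinuousOn h V) : ∀ p ∈ V, h p = 0 := by
  intro p hp
  by_contra hne
  set H : ℕ → ℝ × ℝ → ℂ := fun n p => fderiv ℝ (P n) p (1, 0) + fderiv ℝ (Q n) p (0, 1) with hH
  set ρ : ℝ × ℝ → ℝ := fun q => ((starRingEnd ℂ) (h p) * h q).re with hρ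
  have hρc : ContinuousOn ρ V := Complex.continuous_re.comp_continuousOn
    (continuousOn_const.mul hcont)
  have hρp : 0 < ρ p := by
    simp only [hρ, ← Complex.normSq_eq_conj_mul_self, Complex.ofReal_re]
    exact Complex.normSq_pos.2 hne
  set W : Set (ℝ × ℝ) := V ∩ ρ ⁻¹' Ioi 0
  have hW : IsOpen W := hρc.isOpen_inter_preimage hV isOpen_Ioi
  have hPc : ∀ n, ContinuousOn (P n) V := fun n q hq => (hP n q hq).continuousAt.continuousWithinAt
  have hQc : ∀ n, ContinuousOn (Q n) V := fun n q hq => (hQ n q hq).continuousAt.continuousWithinAt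
  have bdd : ∀ {f : ℕ → ℂ} {l : ℂ}, Tendsto f atTop (𝓝 l) → ∃ C, ∀ n, ‖f n‖ ≤ C := by
    intro f l hf
    obtain ⟨C, hC⟩ := hf.norm.bddAbove_range
    exact ⟨C, fun n => hC (mem_range_self n)⟩
  obtain ⟨O, hOW, hO, ⟨z, hz⟩, C, hC⟩ := exists_isOpen_uniform_bound (W := W)
    (N := fun n q => ‖P n q‖ + ‖Q n q‖ + ‖H n q‖) hW ⟨p, hp, hρp⟩
    (fun n => (((hPc n).norm.add (hQc n).norm).add (hc n).norm).mono inter_subset_left)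
    (fun q hq => by
      obtain ⟨C₁, h₁⟩ := bdd (hP0 q hq.1)
      obtain ⟨C₂, h₂⟩ := bdd (hQ0 q hq.1)
      obtain ⟨C₃, h₃⟩ := bdd (hh q hq.1)
      exact ⟨C₁ + C₂ + C₃, fun n => add_le_add (add_le_add (h₁ n) (h₂ n)) (h₃ n)⟩)
  have hCP : ∀ n, ∀ q ∈ O, ‖P n q‖ ≤ C := fun n q hq => by
    have := hC n q hq; linarith [norm_nonneg (Q n q), norm_nonneg (H n q)]
  have hCQ : ∀ n, ∀ q ∈ O, ‖Q n q‖ ≤ C := fun n q hq => by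
    have := hC n q hq; linarith [norm_nonneg (P n q), norm_nonneg (H n q)]
  have hCH : ∀ n, ∀ q ∈ O, ‖H n q‖ ≤ C := fun n q hq => by
    have := hC n q hq; linarith [norm_nonneg (P n q), norm_nonneg (Q n q)]
  obtain ⟨ε, hε, hball⟩ := Metric.nhds_basis_closedBall.mem_iff.1 (hO.mem_nhds hz)
  obtain ⟨z₁, z₂⟩ := z
  rw [← closedBall_prod_same, Real.closedBall_eq_Icc, Real.closedBall_eq_Icc,
    Icc_prod_Icc] at hball
  set a : ℝ × ℝ := (z₁ - ε, z₂ - ε) with ha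
  set b : ℝ × ℝ := (z₁ + ε, z₂ + ε) with hb
  have h1 : a.1 < b.1 := by simp only [ha, hb]; linarith
  have h2 : a.2 < b.2 := by simp only [ha, hb]; linarith
  have hle : a ≤ b := ⟨h1.le, h2.le⟩
  have h_box : Icc a b ⊆ O := hball
  have hIV : Icc a b ⊆ V := fun q hq => (hOW (h_box hq)).1
  have hdiv : ∀ n, ∫ x in Icc a b, H n x =
      (((∫ x in a.1..b.1, Q n (x, b.2)) - ∫ x in a.1..b.1, Q n (x, a.2)) +
          ∫ y in a.2..b.2, P n (b.1, y)) - ∫ y in a.2..b.2, P n (a.1, y) := by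
    intro n
    have hsub : Ioo a.1 b.1 ×ˢ Ioo a.2 b.2 ⊆ V := fun q hq =>
      hIV ⟨⟨hq.1.1.le, hq.2.1.le⟩, ⟨hq.1.2.le, hq.2.2.le⟩⟩
    exact MeasureTheory.integral_divergence_prod_Icc_of_hasFDerivAt_of_le (P n) (Q n)
      (fderiv ℝ (P n)) (fderiv ℝ (Q n)) a b hle ((hPc n).mono hIV) ((hQc n).mono hIV)
      (fun x hx => (hP n x (hsub hx)).hasFDerivAt) (fun x hx => (hQ n x (hsub hx)).hasFDerivAt)
      (((hc n).mono hIV).integrableOn_compact isCompact_Icc)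
  have row : ∀ y ∈ Icc a.2 b.2, ∀ x ∈ Icc a.1 b.1, (x, y) ∈ Icc a b :=
    fun y hy x hx => ⟨⟨hx.1, hy.1⟩, ⟨hx.2, hy.2⟩⟩
  have hrow : ∀ y ∈ Icc a.2 b.2, Tendsto (fun n => ∫ x in a.1..b.1, Q n (x, y)) atTop (𝓝 0) :=
    fun y hy => tendsto_intervalIntegral_zero h1.le
      (fun n => ((hQc n).mono hIV).comp (by fun_prop) (fun x hx => row y hy x hx))
      (fun n x hx => hCQ n _ (h_box (row y hy x hx))) (fun x hx => hQ0 _ (hIV (row y hy x hx)))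
  have hcol : ∀ x ∈ Icc a.1 b.1, Tendsto (fun n => ∫ y in a.2..b.2, P n (x, y)) atTop (𝓝 0) :=
    fun x hx => tendsto_intervalIntegral_zero h2.le
      (fun n => ((hPc n).mono hIV).comp (by fun_prop) (fun y hy => row y hy x hx))
      (fun n y hy => hCP n _ (h_box (row y hy x hx))) (fun y hy => hP0 _ (hIV (row y hy x hx)))
  have hlim0 : Tendsto (fun n => ∫ x in Icc a b, H n x) atTop (𝓝 0) := by
    simp only [hdiv]
    simpa using (((hrow _ (right_mem_Icc.2 h2.le)).sub (hrow _ (left_mem_Icc.2 h2.le))).add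
      (hcol _ (right_mem_Icc.2 h1.le))).sub (hcol _ (left_mem_Icc.2 h1.le))
  have hlim : Tendsto (fun n => ∫ x in Icc a b, H n x) atTop (𝓝 (∫ x in Icc a b, h x)) := by
    refine MeasureTheory.tendsto_integral_of_dominated_convergence (fun _ => C)
      (fun n => ((hc n).mono hIV).aestronglyMeasurable measurableSet_Icc)
      (MeasureTheory.integrableOn_const (isCompact_Icc.measure_lt_top.ne)) (fun n => ?_) ?_
    · exact (MeasureTheory.ae_restrict_iff' measurableSet_Icc).2
        (Eventually.of_forall fun q hq => hCH n q (h_box hq))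
    · exact (MeasureTheory.ae_restrict_iff' measurableSet_Icc).2
        (Eventually.of_forall fun q hq => hh q (hIV hq))
  have hzero : ∫ x in Icc a b, h x = 0 := tendsto_nhds_unique hlim hlim0
  have h_integrable : MeasureTheory.IntegrableOn h (Icc a b) :=
    (hcont.mono hIV).integrableOn_compact isCompact_Icc
  have hρint : ∫ x in Icc a b, ρ x = 0 := by
    have e1 : ∫ x in Icc a b, ρ x = (∫ x in Icc a b, (starRingEnd ℂ) (h p) * h x).re :=
      integral_re (h_integrable.const_mul _)
    rw [e1, MeasureTheory.integral_const_mul, hzero, mul_zero, Complex.zero_re]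
  have hρpos : 0 < ∫ x in Icc a b, ρ x := by
    rw [MeasureTheory.setIntegral_pos_iff_support_of_nonneg_ae]
    · have hsupp : Icc a b ⊆ Function.support ρ ∩ Icc a b := fun q hq =>
        ⟨(ne_of_gt (hOW (h_box hq)).2 : ρ q ≠ 0), hq⟩
      refine lt_of_lt_of_le ?_ (MeasureTheory.measure_mono hsupp)
      rw [← Icc_prod_Icc, MeasureTheory.Measure.volume_eq_prod, MeasureTheory.Measure.prod_prod,
        Real.volume_Icc, Real.volume_Icc]
      exact ENNReal.mul_pos (by simpa using hε) (by simpa using hε)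
    · exact (MeasureTheory.ae_restrict_iff' measurableSet_Icc).2
        (Eventually.of_forall fun q hq => le_of_lt (hOW (h_box hq)).2)
    · exact (hρc.mono hIV).integrableOn_compact isCompact_Icc
  exact absurd hρint hρpos.ne'

/-- Spacetime points `(t, r, ϑ, φ)`. -/
abbrev E4 : Type := ℝ × ℝ × ℝ × ℝ

/-- Uncurrying. -/
def unc (u : F4) : E4 → ℂ := fun p => u p.1 p.2.1 p.2.2.1 p.2.2.2

/-- The derivative in direction `e`. -/
def dirD (e : E4) (U : E4 → ℂ) : E4 → ℂ := fun p => fderiv ℝ U p e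

/-- The unit vectors of the coordinates `t`, `r`, `ϑ`, `φ`. -/
def eT : E4 := (1, 0, 0, 0)
def eR : E4 := (0, 1, 0, 0)
def eTh : E4 := (0, 0, 1, 0)
def ePh : E4 := (0, 0, 0, 1)

/-- Smoothness on the exterior region. -/
def Sm (rp : ℝ) (U : E4 → ℂ) : Prop := ContDiffOn ℝ (⊤ : ℕ∞) U (OmSet rp)

theorem sin_ne_zero_of_mem {rp : ℝ} {p : E4} (hp : p ∈ OmSet rp) : Real.sin p.2.2.1 ≠ 0 :=
  (Real.sin_pos_of_pos_of_lt_pi hp.2.1 hp.2.2).ne'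

theorem two_le_smooth : (2 : WithTop ℕ∞) ≤ ((⊤ : ℕ∞) : WithTop ℕ∞) := by
  exact WithTop.coe_le_coe.2 (le_top : (2 : ℕ∞) ≤ ⊤)

namespace Sm

variable {rp : ℝ} {U V W : E4 → ℂ}

theorem differentiableAt (hU : Sm rp U) {p : E4} (hp : p ∈ OmSet rp) : DifferentiableAt ℝ U p :=
  ((hU.contDiffAt ((isOpen_OmSet rp).mem_nhds hp)).differentiableAt (by simp))

theorem dirD (hU : Sm rp U) (e : E4) : Sm rp (dirD e U) := by
  have := hU.fderiv_of_isOpen (m := (⊤ : ℕ∞)) (isOpen_OmSet rp) (by simp)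
  exact this.clm_apply contDiffOn_const

theorem congr (hU : Sm rp U) (h : EqOn V U (OmSet rp)) : Sm rp V := ContDiffOn.congr hU h

theorem add (hU : Sm rp U) (hV : Sm rp V) : Sm rp (fun p => U p + V p) := ContDiffOn.add hU hV

theorem sub (hU : Sm rp U) (hV : Sm rp V) : Sm rp (fun p => U p - V p) := ContDiffOn.sub hU hV

theorem mul (hU : Sm rp U) (hV : Sm rp V) : Sm rp (fun p => U p * V p) := ContDiffOn.mul hU hV

theorem const (c : ℂ) : Sm rp (fun _ => c) := contDiffOn_const

theorem ofReal {f : E4 → ℝ} (hf : ContDiffOn ℝ (⊤ : ℕ∞) f (OmSet rp)) :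
    Sm rp (fun p => (f p : ℂ)) :=
  Complex.ofRealCLM.contDiff.comp_contDiffOn hf

theorem hasDerivAt_line (hU : Sm rp U) {p : E4} (hp : p ∈ OmSet rp) (e : E4) :
    HasDerivAt (fun s : ℝ => U (p + s • e)) (Grav.dirD e U p) 0 :=
  (hU.differentiableAt hp).hasFDerivAt.hasLineDerivAt e

theorem dirD_eq (hU : Sm rp U) {p : E4} (hp : p ∈ OmSet rp) {e : E4} {d : ℂ}
    (h : HasDerivAt (fun s : ℝ => U (p + s • e)) d 0) : Grav.dirD e U p = d :=
  (hU.hasDerivAt_line hp e).unique h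

theorem dirD_comm (hU : Sm rp U) (e f : E4) :
    EqOn (Grav.dirD e (Grav.dirD f U)) (Grav.dirD f (Grav.dirD e U)) (OmSet rp) := by
  intro p hp
  have hc : ContDiffAt ℝ (⊤ : ℕ∞) U p := hU.contDiffAt ((isOpen_OmSet rp).mem_nhds hp)
  have hsymm : IsSymmSndFDerivAt ℝ U p := hc.isSymmSndFDerivAt (by simpa using two_le_smooth)
  have hd : DifferentiableAt ℝ (fderiv ℝ U) p :=
    (hc.fderiv_right (m := 1) (by simpa [one_add_one_eq_two] using two_le_smooth)).differentiableAt
      (by simp)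
  have key : ∀ e f : E4, Grav.dirD e (Grav.dirD f U) p = fderiv ℝ (fderiv ℝ U) p e f := by
    intro e f
    have h := fderiv_clm_apply hd (differentiableAt_const f)
    change fderiv ℝ (fun y => fderiv ℝ U y f) p e = _
    rw [h]
    simp
  rw [key, key]
  exact hsymm e f

end Sm

theorem dirD_congr {rp : ℝ} {U V : E4 → ℂ} (h : EqOn U V (OmSet rp)) (e : E4) :
    EqOn (dirD e U) (dirD e V) (OmSet rp) := fun p hp => by
  have : U =ᶠ[𝓝 p] V := h.eventuallyEq_of_mem ((isOpen_OmSet rp).mem_nhds hp)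
  simp only [dirD, this.fderiv_eq]

/-- The derivative of a combination with coefficients depending on `r`. -/
theorem dirD_comb {rp : ℝ} {W U₁ U₂ U₃ : E4 → ℂ} {g₁ g₂ g₃ g₁' g₂' g₃' : ℝ → ℂ}
    (hW : Sm rp W) (h₁ : Sm rp U₁) (h₂ : Sm rp U₂) (h₃ : Sm rp U₃)
    (hg₁ : ∀ r > rp, HasDerivAt g₁ (g₁' r) r) (hg₂ : ∀ r > rp, HasDerivAt g₂ (g₂' r) r)
    (hg₃ : ∀ r > rp, HasDerivAt g₃ (g₃' r) r)
    (h : EqOn W (fun p => g₁ p.2.1 * U₁ p + g₂ p.2.1 * U₂ p + g₃ p.2.1 * U₃ p) (OmSet rp))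
    (e : E4) :
    EqOn (dirD e W) (fun p => g₁ p.2.1 * dirD e U₁ p + g₂ p.2.1 * dirD e U₂ p
      + g₃ p.2.1 * dirD e U₃ p
      + e.2.1 * (g₁' p.2.1 * U₁ p + g₂' p.2.1 * U₂ p + g₃' p.2.1 * U₃ p)) (OmSet rp) := by
  intro p hp
  have hl : HasDerivAt (fun s : ℝ => (p + s • e).2.1) e.2.1 0 := by
    have h0 : HasDerivAt (fun s : ℝ => p.2.1 + s * e.2.1) (1 * e.2.1) 0 :=
      ((hasDerivAt_id (0 : ℝ)).mul_const e.2.1).const_add p.2.1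
    simpa using h0
  have term : ∀ {U : E4 → ℂ} {g g' : ℝ → ℂ}, Sm rp U → (∀ r > rp, HasDerivAt g (g' r) r) →
      HasDerivAt (fun s : ℝ => g (p + s • e).2.1 * U (p + s • e))
        (e.2.1 * g' p.2.1 * U p + g p.2.1 * dirD e U p) 0 := by
    intro U g g' hU hg
    have hg0 : HasDerivAt g (g' p.2.1) (p + (0 : ℝ) • e).2.1 := by simpa using hg _ hp.1
    have := (hg0.scomp (0 : ℝ) hl).mul (hU.hasDerivAt_line hp e)
    refine this.congr_deriv ?_
    simp
  refine hW.dirD_eq hp ?_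
  have hev : (fun s : ℝ => W (p + s • e)) =ᶠ[𝓝 0] fun s : ℝ =>
      g₁ (p + s • e).2.1 * U₁ (p + s • e) + g₂ (p + s • e).2.1 * U₂ (p + s • e)
        + g₃ (p + s • e).2.1 * U₃ (p + s • e) := by
    have hcl : ContinuousAt (fun s : ℝ => p + s • e) 0 := by fun_prop
    have : ∀ᶠ s : ℝ in 𝓝 0, p + s • e ∈ OmSet rp :=
      hcl.eventually_mem (by simpa using (isOpen_OmSet rp).mem_nhds hp)
    filter_upwards [this] with s hs using h hs
  refine HasDerivAt.congr_of_eventuallyEq ?_ hev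
  refine (((term h₁ hg₁).add (term h₂ hg₂)).add (term h₃ hg₃)).congr_deriv ?_
  ring

/-- The angular operator in terms of directional derivatives. -/
def angU (U : E4 → ℂ) : E4 → ℂ := fun p =>
  - dirD eTh (dirD eTh U) p
  - ((Real.cos p.2.2.1 / Real.sin p.2.2.1 : ℝ) : ℂ) * dirD eTh U p
  - (((Real.sin p.2.2.1) ^ 2 : ℝ) : ℂ)⁻¹ * dirD ePh (dirD ePh U) p
  - 4 * Complex.I * ((Real.cos p.2.2.1 / (Real.sin p.2.2.1) ^ 2 : ℝ) : ℂ) * dirD ePh U p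
  + 4 * (((Real.cos p.2.2.1 / Real.sin p.2.2.1) ^ 2 : ℝ) : ℂ) * U p
  + 4 * U p

theorem contDiffOn_sin_coord (rp : ℝ) :
    ContDiffOn ℝ (⊤ : ℕ∞) (fun p : E4 => Real.sin p.2.2.1) (OmSet rp) :=
  (Real.contDiff_sin.comp (by fun_prop)).contDiffOn

theorem contDiffOn_cos_coord (rp : ℝ) :
    ContDiffOn ℝ (⊤ : ℕ∞) (fun p : E4 => Real.cos p.2.2.1) (OmSet rp) :=
  (Real.contDiff_cos.comp (by fun_prop)).contDiffOn

theorem Sm.angU {rp : ℝ} {U : E4 → ℂ} (hU : Sm rp U) : Sm rp (angU U) := by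
  have hs := contDiffOn_sin_coord rp
  have hc := contDiffOn_cos_coord rp
  have hs0 : ∀ p ∈ OmSet rp, Real.sin p.2.2.1 ≠ 0 := fun p hp => sin_ne_zero_of_mem hp
  have hs20 : ∀ p ∈ OmSet rp, Real.sin p.2.2.1 ^ 2 ≠ 0 := fun p hp => pow_ne_zero 2 (hs0 p hp)
  have k1 : Sm rp (fun p => ((Real.cos p.2.2.1 / Real.sin p.2.2.1 : ℝ) : ℂ)) :=
    Sm.ofReal (hc.div hs hs0)
  have k2 : Sm rp (fun p => (((Real.sin p.2.2.1) ^ 2 : ℝ) : ℂ)⁻¹) :=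
    (Sm.ofReal (hs.pow 2)).inv fun p hp => Complex.ofReal_ne_zero.2 (hs20 p hp)
  have k3 : Sm rp (fun p => ((Real.cos p.2.2.1 / (Real.sin p.2.2.1) ^ 2 : ℝ) : ℂ)) :=
    Sm.ofReal (hc.div (hs.pow 2) hs20)
  have k4 : Sm rp (fun p => (((Real.cos p.2.2.1 / Real.sin p.2.2.1) ^ 2 : ℝ) : ℂ)) :=
    Sm.ofReal ((hc.div hs hs0).pow 2)
  exact (((((((hU.dirD eTh).dirD eTh).neg.sub (k1.mul (hU.dirD eTh))).sub
    (k2.mul ((hU.dirD ePh).dirD ePh))).sub (((Sm.const (4 * Complex.I)).mul k3).mul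
    (hU.dirD ePh))).add (((Sm.const 4).mul k4).mul hU)).add ((Sm.const 4).mul hU))

theorem angU_congr {rp : ℝ} {U V : E4 → ℂ} (h : EqOn U V (OmSet rp)) :
    EqOn (angU U) (angU V) (OmSet rp) := fun p hp => by
  simp only [angU, h hp, dirD_congr h eTh hp, dirD_congr h ePh hp,
    dirD_congr (dirD_congr h eTh) eTh hp, dirD_congr (dirD_congr h ePh) ePh hp]

theorem angU_comb {rp : ℝ} {W U₁ U₂ U₃ : E4 → ℂ} {g₁ g₂ g₃ g₁' g₂' g₃' : ℝ → ℂ}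
    (hW : Sm rp W) (h₁ : Sm rp U₁) (h₂ : Sm rp U₂) (h₃ : Sm rp U₃)
    (hg₁ : ∀ r > rp, HasDerivAt g₁ (g₁' r) r) (hg₂ : ∀ r > rp, HasDerivAt g₂ (g₂' r) r)
    (hg₃ : ∀ r > rp, HasDerivAt g₃ (g₃' r) r)
    (h : EqOn W (fun p => g₁ p.2.1 * U₁ p + g₂ p.2.1 * U₂ p + g₃ p.2.1 * U₃ p) (OmSet rp)) :
    EqOn (angU W) (fun p => g₁ p.2.1 * angU U₁ p + g₂ p.2.1 * angU U₂ p
      + g₃ p.2.1 * angU U₃ p) (OmSet rp) := by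
  have first : ∀ {e : E4}, e.2.1 = 0 → ∀ {W U₁ U₂ U₃ : E4 → ℂ}, Sm rp W → Sm rp U₁ → Sm rp U₂ →
      Sm rp U₃ →
      EqOn W (fun p => g₁ p.2.1 * U₁ p + g₂ p.2.1 * U₂ p + g₃ p.2.1 * U₃ p) (OmSet rp) →
      EqOn (dirD e W) (fun p => g₁ p.2.1 * dirD e U₁ p + g₂ p.2.1 * dirD e U₂ p
        + g₃ p.2.1 * dirD e U₃ p) (OmSet rp) := by
    intro e he W U₁ U₂ U₃ hW h₁ h₂ h₃ h p hp
    have := dirD_comb hW h₁ h₂ h₃ hg₁ hg₂ hg₃ h e hp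
    simpa [he] using this
  have hTh := first (e := eTh) rfl hW h₁ h₂ h₃ h
  have hPh := first (e := ePh) rfl hW h₁ h₂ h₃ h
  have hTh2 := first (e := eTh) rfl (hW.dirD _) (h₁.dirD _) (h₂.dirD _) (h₃.dirD _) hTh
  have hPh2 := first (e := ePh) rfl (hW.dirD _) (h₁.dirD _) (h₂.dirD _) (h₃.dirD _) hPh
  intro p hp
  simp only [angU, h hp, hTh hp, hPh hp, hTh2 hp, hPh2 hp]
  ring

theorem dirD_angU {rp : ℝ} {U : E4 → ℂ} (hU : Sm rp U) {e : E4} (he : e.2.2.1 = 0) :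
    EqOn (dirD e (angU U)) (angU (dirD e U)) (OmSet rp) := by
  intro p hp
  refine hU.angU.dirD_eq hp ?_
  have hϑ : ∀ s : ℝ, (p + s • e).2.2.1 = p.2.2.1 := fun s => by simp [he]
  simp only [angU, hϑ]
  have c1 := hU.dirD_comm e eTh
  have c2 := hU.dirD_comm e ePh
  have c3 := ((hU.dirD eTh).dirD_comm e eTh).trans (dirD_congr c1 eTh)
  have c4 := ((hU.dirD ePh).dirD_comm e ePh).trans (dirD_congr c2 ePh)
  rw [← c1 hp, ← c2 hp, ← c3 hp, ← c4 hp]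
  exact (((((((hU.dirD eTh).dirD eTh).hasDerivAt_line hp e).neg.sub
    (((hU.dirD eTh).hasDerivAt_line hp e).const_mul _)).sub
    ((((hU.dirD ePh).dirD ePh).hasDerivAt_line hp e).const_mul _)).sub
    (((hU.dirD ePh).hasDerivAt_line hp e).const_mul _)).add
    ((hU.hasDerivAt_line hp e).const_mul _)).add ((hU.hasDerivAt_line hp e).const_mul _)

/-- `Δ/r²`. -/
def ccR (M k r : ℝ) : ℝ := Del M k r / r ^ 2
/-- `w′/w`. -/
def ffR (M r : ℝ) : ℝ := (6 * M - 2 * r) / r ^ 2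
/-- `6M/r`. -/
def mmR (M r : ℝ) : ℝ := 6 * M / r

theorem hasDerivAt_ccR (M k : ℝ) {r : ℝ} (hr : 0 < r) :
    HasDerivAt (fun s => (ccR M k s : ℂ)) ((2 * k ^ 2 * r + 2 * M / r ^ 2 : ℝ) : ℂ) r := by
  refine HasDerivAt.ofReal_comp (f := fun s => ccR M k s) ?_
  have h1 : HasDerivAt (fun s : ℝ => s ^ 2 + k ^ 2 * s ^ 4 - 2 * M * s)
      (2 * r + k ^ 2 * (4 * r ^ 3) - 2 * M) r := by
    refine (((hasDerivAt_pow 2 r).add ((hasDerivAt_pow 4 r).const_mul (k ^ 2))).sub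
      ((hasDerivAt_id r).const_mul (2 * M))).congr_deriv ?_
    norm_num
  refine (h1.div (hasDerivAt_pow 2 r) (by positivity)).congr_deriv ?_
  field_simp
  ring

theorem hasDerivAt_ww (M k : ℝ) {r : ℝ} (hr : 0 < r) :
    HasDerivAt (fun s => (ww M k s : ℂ)) ((-2 / r ^ 3 + 6 * M / r ^ 4 : ℝ) : ℂ) r := by
  refine HasDerivAt.ofReal_comp (f := fun s => ww M k s) ?_
  have h1 : HasDerivAt (fun s : ℝ => s ^ 2 + k ^ 2 * s ^ 4 - 2 * M * s)
      (2 * r + k ^ 2 * (4 * r ^ 3) - 2 * M) r := by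
    refine (((hasDerivAt_pow 2 r).add ((hasDerivAt_pow 4 r).const_mul (k ^ 2))).sub
      ((hasDerivAt_id r).const_mul (2 * M))).congr_deriv ?_
    norm_num
  refine (h1.div (hasDerivAt_pow 4 r) (by positivity)).congr_deriv ?_
  field_simp
  ring

theorem hasDerivAt_ffR (M : ℝ) {r : ℝ} (hr : 0 < r) :
    HasDerivAt (fun s => (ffR M s : ℂ)) ((-12 * M / r ^ 3 + 2 / r ^ 2 : ℝ) : ℂ) r := by
  refine HasDerivAt.ofReal_comp (f := fun s => ffR M s) ?_
  have h1 : HasDerivAt (fun s : ℝ => 6 * M - 2 * s) (-2) r := by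
    simpa using ((hasDerivAt_id r).const_mul 2).const_sub (6 * M)
  refine (h1.div (hasDerivAt_pow 2 r) (by positivity)).congr_deriv ?_
  field_simp
  ring

theorem hasDerivAt_mmR (M : ℝ) {r : ℝ} (hr : 0 < r) :
    HasDerivAt (fun s => (mmR M s : ℂ)) ((-6 * M / r ^ 2 : ℝ) : ℂ) r := by
  refine HasDerivAt.ofReal_comp (f := fun s => mmR M s) ?_
  refine ((hasDerivAt_const r (6 * M)).div (hasDerivAt_id r) hr.ne').congr_deriv ?_
  simp

theorem ww_pos {M k rp : ℝ} (hrp : 0 < rp) (hroot : rp + k ^ 2 * rp ^ 3 - 2 * M = 0) {r : ℝ}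
    (hr : rp < r) : 0 < ww M k r := by
  have hr0 : 0 < r := hrp.trans hr
  have h3 : k ^ 2 * rp ^ 3 ≤ k ^ 2 * r ^ 3 := by gcongr
  have : Del M k r = r * (r + k ^ 2 * r ^ 3 - 2 * M) := by unfold Del; ring
  unfold ww
  rw [this]
  have : 0 < r + k ^ 2 * r ^ 3 - 2 * M := by linarith
  positivity

theorem Sm.radial {rp : ℝ} {f : ℝ → ℝ} (hf : ContDiffOn ℝ (⊤ : ℕ∞) f (Ioi rp)) :
    Sm rp (fun p => (f p.2.1 : ℂ)) :=
  Sm.ofReal (hf.comp (contDiff_fst.comp contDiff_snd).contDiffOn fun _ hp => hp.1)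

theorem Sm.ccR {M k rp : ℝ} (hrp : 0 < rp) : Sm rp (fun p => (ccR M k p.2.1 : ℂ)) := by
  refine Sm.radial ?_
  unfold Grav.ccR Del
  exact ContDiffOn.div (by fun_prop) (by fun_prop) fun r hr => (pow_pos (hrp.trans hr) 2).ne'

theorem Sm.ww {M k rp : ℝ} (hrp : 0 < rp) : Sm rp (fun p => (ww M k p.2.1 : ℂ)) := by
  refine Sm.radial ?_
  unfold Grav.ww Del
  exact ContDiffOn.div (by fun_prop) (by fun_prop) fun r hr => (pow_pos (hrp.trans hr) 4).ne'

theorem Sm.ww_inv {M k rp : ℝ} (hrp : 0 < rp) (hroot : rp + k ^ 2 * rp ^ 3 - 2 * M = 0) :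
    Sm rp (fun p => (Grav.ww M k p.2.1 : ℂ)⁻¹) :=
  ContDiffOn.inv (Sm.ww hrp) fun _ hp => Complex.ofReal_ne_zero.2 (ww_pos hrp hroot hp.1).ne'

/-- `∂ₜ + ε (Δ/r²) ∂ᵣ`; the values `ε = 1, -1` give `L`, `L̲`. -/
def opU (M k : ℝ) (ε : ℂ) (U : E4 → ℂ) : E4 → ℂ := fun p =>
  dirD eT U p + ε * (ccR M k p.2.1 : ℂ) * dirD eR U p

section opU

variable {M k rp : ℝ} {U : E4 → ℂ}

theorem Sm.opU (hrp : 0 < rp) (hU : Sm rp U) (ε : ℂ) : Sm rp (opU M k ε U) :=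
  (hU.dirD eT).add (((Sm.const ε).mul (Sm.ccR hrp)).mul (hU.dirD eR))

theorem opU_comb {W U₁ U₂ U₃ : E4 → ℂ} {g₁ g₂ g₃ g₁' g₂' g₃' : ℝ → ℂ}
    (hW : Sm rp W) (h₁ : Sm rp U₁) (h₂ : Sm rp U₂) (h₃ : Sm rp U₃)
    (hg₁ : ∀ r > rp, HasDerivAt g₁ (g₁' r) r) (hg₂ : ∀ r > rp, HasDerivAt g₂ (g₂' r) r)
    (hg₃ : ∀ r > rp, HasDerivAt g₃ (g₃' r) r)
    (h : EqOn W (fun p => g₁ p.2.1 * U₁ p + g₂ p.2.1 * U₂ p + g₃ p.2.1 * U₃ p) (OmSet rp))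
    (ε : ℂ) :
    EqOn (opU M k ε W) (fun p => g₁ p.2.1 * opU M k ε U₁ p + g₂ p.2.1 * opU M k ε U₂ p
      + g₃ p.2.1 * opU M k ε U₃ p + ε * (ccR M k p.2.1 : ℂ) *
        (g₁' p.2.1 * U₁ p + g₂' p.2.1 * U₂ p + g₃' p.2.1 * U₃ p)) (OmSet rp) := by
  intro p hp
  have hT := dirD_comb hW h₁ h₂ h₃ hg₁ hg₂ hg₃ h eT hp
  have hR := dirD_comb hW h₁ h₂ h₃ hg₁ hg₂ hg₃ h eR hp
  simp only [opU, hT, hR]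
  simp only [eT, eR, Complex.ofReal_zero, Complex.ofReal_one]
  ring

theorem opU_angU (hrp : 0 < rp) (hU : Sm rp U) (ε : ℂ) :
    EqOn (opU M k ε (angU U)) (angU (opU M k ε U)) (OmSet rp) := by
  intro p hp
  have h := angU_comb (g₁ := fun _ => 1) (g₂ := fun r => ε * (ccR M k r : ℂ)) (g₃ := fun _ => 0)
    (g₁' := fun _ => 0) (g₃' := fun _ => 0) (hU.opU (M := M) (k := k) hrp ε) (hU.dirD eT)
    (hU.dirD eR) hU (fun r _ => hasDerivAt_const r _)
    (fun r hr => (hasDerivAt_ccR M k (hrp.trans hr)).const_mul ε) (fun r _ => hasDerivAt_const r _)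
    (fun p _ => by simp [opU]) hp
  rw [h]
  simp only [opU, dirD_angU hU (e := eT) rfl hp, dirD_angU hU (e := eR) rfl hp]
  ring

theorem opU_comm (hrp : 0 < rp) (hU : Sm rp U) (ε ε' : ℂ) :
    EqOn (opU M k ε (opU M k ε' U)) (opU M k ε' (opU M k ε U)) (OmSet rp) := by
  have key : ∀ ε ε' : ℂ, EqOn (opU M k ε (opU M k ε' U)) (fun p =>
      opU M k ε (dirD eT U) p + ε' * (ccR M k p.2.1 : ℂ) * opU M k ε (dirD eR U) p
      + ε * (ccR M k p.2.1 : ℂ) * (ε' * ((2 * k ^ 2 * p.2.1 + 2 * M / p.2.1 ^ 2 : ℝ) : ℂ)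
        * dirD eR U p)) (OmSet rp) := by
    intro ε ε' p hp
    have h := opU_comb (M := M) (k := k) (g₁ := fun _ => 1) (g₂ := fun r => ε' * (ccR M k r : ℂ))
      (g₃ := fun _ => 0) (g₁' := fun _ => 0) (g₃' := fun _ => 0)
      (hU.opU (M := M) (k := k) hrp ε') (hU.dirD eT) (hU.dirD eR) hU
      (fun r _ => hasDerivAt_const r _)
      (fun r hr => (hasDerivAt_ccR M k (hrp.trans hr)).const_mul ε')
      (fun r _ => hasDerivAt_const r _) (fun p _ => by simp [opU]) ε hp
    rw [h]
    ring
  intro p hp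
  rw [key ε ε' hp, key ε' ε hp]
  simp only [opU, hU.dirD_comm eR eT hp]
  ring

end opU

/-- The transport identities satisfied by the Chandrasekhar transforms `x = w⁻¹L₋a`,
`X = w⁻¹L₋x` of a Teukolsky solution `a`, where `L₋ = ∂ₜ - ε(Δ/r²)∂ᵣ`. -/
theorem chandrasekhar_identities {M k rp : ℝ} (hrp : 0 < rp)
    (hroot : rp + k ^ 2 * rp ^ 3 - 2 * M = 0) {a x X : E4 → ℂ} (ha : Sm rp a) (hx : Sm rp x)
    (hX : Sm rp X) {ε : ℂ} (hε : ε * ε = 1)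
    (h1 : EqOn (opU M k (-ε) a) (fun p => (ww M k p.2.1 : ℂ) * x p) (OmSet rp))
    (h2 : EqOn (opU M k (-ε) x) (fun p => (ww M k p.2.1 : ℂ) * X p) (OmSet rp))
    (hT : ∀ p ∈ OmSet rp, opU M k ε (opU M k (-ε) a) p
      - 2 * ε * (ffR M p.2.1 : ℂ) * opU M k (-ε) a p
      + (ww M k p.2.1 : ℂ) * (angU a p - 2 * a p + (mmR M p.2.1 : ℂ) * a p) = 0) :
    EqOn (opU M k ε x)
      (fun p => ε * (ffR M p.2.1 : ℂ) * x p - angU a p + (2 - (mmR M p.2.1 : ℂ)) * a p)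
      (OmSet rp) ∧
    EqOn (opU M k ε X)
      (fun p => - angU x p + (mmR M p.2.1 : ℂ) * x p - 6 * M * ε * a p) (OmSet rp) ∧
    EqOn (opU M k ε (opU M k ε X))
      (fun p => - ε * (ffR M p.2.1 : ℂ) * angU x p + angU (angU a) p
        - (2 - (mmR M p.2.1 : ℂ)) * angU a p
        + (mmR M p.2.1 : ℂ) * (ε * (ffR M p.2.1 : ℂ) * x p - angU a p
          + (2 - (mmR M p.2.1 : ℂ)) * a p)
        - 12 * M * ε * dirD eT a p) (OmSet rp) := by
  have hw0 : ∀ p ∈ OmSet rp, (ww M k p.2.1 : ℂ) ≠ 0 := fun p hp =>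
    Complex.ofReal_ne_zero.2 (ww_pos hrp hroot hp.1).ne'
  have hdw : ∀ r > rp, HasDerivAt (fun s => (ww M k s : ℂ))
      ((-2 / r ^ 3 + 6 * M / r ^ 4 : ℝ) : ℂ) r := fun r hr => hasDerivAt_ww M k (hrp.trans hr)
  have hdf : ∀ r > rp, HasDerivAt (fun s => (ffR M s : ℂ))
      ((-12 * M / r ^ 3 + 2 / r ^ 2 : ℝ) : ℂ) r := fun r hr => hasDerivAt_ffR M (hrp.trans hr)
  have hdm : ∀ r > rp, HasDerivAt (fun s => (mmR M s : ℂ))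
      ((-6 * M / r ^ 2 : ℝ) : ℂ) r := fun r hr => hasDerivAt_mmR M (hrp.trans hr)
  have cw : ∀ p ∈ OmSet rp, (ccR M k p.2.1 : ℂ) * ((-2 / p.2.1 ^ 3 + 6 * M / p.2.1 ^ 4 : ℝ) : ℂ)
      = (ww M k p.2.1 : ℂ) * (ffR M p.2.1 : ℂ) := fun p hp => by
    have hr : p.2.1 ≠ 0 := (hrp.trans hp.1).ne'
    rw [← Complex.ofReal_mul, ← Complex.ofReal_mul]
    unfold ccR ww ffR
    congr 1
    field_simp
    ring
  have cf : ∀ p ∈ OmSet rp, (ccR M k p.2.1 : ℂ) * ((-12 * M / p.2.1 ^ 3 + 2 / p.2.1 ^ 2 : ℝ) : ℂ)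
      = (ww M k p.2.1 : ℂ) * (2 - 2 * (mmR M p.2.1 : ℂ)) := fun p hp => by
    have hr : p.2.1 ≠ 0 := (hrp.trans hp.1).ne'
    have hrc : (p.2.1 : ℂ) ≠ 0 := Complex.ofReal_ne_zero.2 hr
    unfold ccR ww mmR
    push_cast
    field_simp
    ring
  have cm : ∀ p ∈ OmSet rp, (ccR M k p.2.1 : ℂ) * ((-6 * M / p.2.1 ^ 2 : ℝ) : ℂ)
      = - 6 * (M : ℂ) * (ww M k p.2.1 : ℂ) := fun p hp => by
    have hr : p.2.1 ≠ 0 := (hrp.trans hp.1).ne'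
    have hrc : (p.2.1 : ℂ) ≠ 0 := Complex.ofReal_ne_zero.2 hr
    unfold ccR ww
    push_cast
    field_simp
  have wcomb : ∀ {U V : E4 → ℂ}, Sm rp U → Sm rp V →
      EqOn U (fun p => (ww M k p.2.1 : ℂ) * V p) (OmSet rp) →
      EqOn (opU M k ε U) (fun p => (ww M k p.2.1 : ℂ) *
        (opU M k ε V p + ε * (ffR M p.2.1 : ℂ) * V p)) (OmSet rp) := by
    intro U V hU hV h p hp
    have := opU_comb (M := M) (k := k) (g₂ := fun _ => 0) (g₃ := fun _ => 0) (g₂' := fun _ => 0)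
      (g₃' := fun _ => 0) hU hV hV hV hdw (fun r _ => hasDerivAt_const r _)
      (fun r _ => hasDerivAt_const r _) (fun p hp => by simp [h hp]) ε hp
    rw [this]
    linear_combination ε * V p * cw p hp
  have E1 : EqOn (opU M k ε x) (fun p => ε * (ffR M p.2.1 : ℂ) * x p - angU a p
      + (2 - (mmR M p.2.1 : ℂ)) * a p) (OmSet rp) := by
    intro p hp
    have h := hT p hp
    rw [wcomb (ha.opU hrp _) hx h1 hp, h1 hp] at h
    refine mul_left_cancel₀ (hw0 p hp) ?_
    linear_combination h
  have E2 : EqOn (opU M k ε X)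
      (fun p => - angU x p + (mmR M p.2.1 : ℂ) * x p - 6 * M * ε * a p) (OmSet rp) := by
    intro p hp
    have hl := wcomb (hx.opU hrp _) hX h2 hp
    have hr := opU_comb (M := M) (k := k) (g₁ := fun r => ε * (ffR M r : ℂ)) (g₂ := fun _ => -1)
      (g₃ := fun r => 2 - (mmR M r : ℂ)) (g₂' := fun _ => 0)
      (hx.opU hrp ε) hx ha.angU ha
      (fun r hr => (hdf r hr).const_mul ε) (fun r _ => hasDerivAt_const r _)
      (fun r hr => (hdm r hr).const_sub 2) (fun p hp => by rw [E1 hp]; ring) (-ε) hp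
    have hA : opU M k (-ε) (angU a) p = (ww M k p.2.1 : ℂ) * angU x p := by
      rw [opU_angU hrp ha (-ε) hp]
      have := angU_comb (g₂ := fun _ => 0) (g₃ := fun _ => 0) (g₂' := fun _ => 0)
        (g₃' := fun _ => 0) (ha.opU (M := M) (k := k) hrp (-ε)) hx hx hx hdw
        (fun r _ => hasDerivAt_const r _)
        (fun r _ => hasDerivAt_const r _) (fun p hp => by simp [h1 hp]) hp
      rw [this]; ring
    rw [opU_comm hrp hx ε (-ε) hp] at hl
    rw [hl] at hr
    beta_reduce at hr
    rw [hA, h1 hp, h2 hp] at hr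
    beta_reduce at hr
    refine mul_left_cancel₀ (hw0 p hp) ?_
    linear_combination hr - ε * ε * x p * cf p hp + ε * a p * cm p hp
      - (ww M k p.2.1 : ℂ) * (2 - 2 * (mmR M p.2.1 : ℂ)) * x p * hε
  refine ⟨E1, E2, fun p hp => ?_⟩
  have hl := opU_comb (M := M) (k := k) (g₁ := fun _ => -1) (g₂ := fun r => (mmR M r : ℂ))
    (g₃ := fun _ => - (6 * M * ε)) (g₁' := fun _ => 0) (g₃' := fun _ => 0)
    (hX.opU hrp ε) hx.angU hx ha (fun r _ => hasDerivAt_const r _) hdm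
    (fun r _ => hasDerivAt_const r _) (fun p hp => by rw [E2 hp]; ring) ε hp
  have hA : opU M k ε (angU x) p = ε * (ffR M p.2.1 : ℂ) * angU x p - angU (angU a) p
      + (2 - (mmR M p.2.1 : ℂ)) * angU a p := by
    rw [opU_angU hrp hx ε hp]
    have := angU_comb (g₁ := fun r => ε * (ffR M r : ℂ)) (g₂ := fun _ => -1)
      (g₃ := fun r => 2 - (mmR M r : ℂ)) (g₂' := fun _ => 0)
      (hx.opU (M := M) (k := k) hrp ε) hx ha.angU ha
      (fun r hr => (hdf r hr).const_mul ε) (fun r _ => hasDerivAt_const r _)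
      (fun r hr => (hdm r hr).const_sub 2) (fun p hp => by rw [E1 hp]; ring) hp
    rw [this]; ring
  have ha2 : opU M k ε a p = 2 * dirD eT a p - (ww M k p.2.1 : ℂ) * x p := by
    have := h1 hp
    simp only [opU] at this ⊢
    linear_combination -this
  rw [hl]
  beta_reduce
  rw [hA, ha2, E1 hp]
  beta_reduce
  linear_combination ε * x p * cm p hp

/-- Convergence to zero at infinity. -/
def TZ (U : E4 → ℂ) : Prop :=
  ∀ t φ : ℝ, ∀ ϑ ∈ Ioo (0 : ℝ) Real.pi, Tendsto (fun r => U (t, r, ϑ, φ)) atTop (𝓝 0)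

/-- The uncurried form of `Nice`. -/
def NiceU (U : E4 → ℂ) : Prop :=
  ∃ q0 : ℝ → ℝ → ℝ → ℂ,
    ContDiffOn ℝ (⊤ : ℕ∞) (fun p : ℝ × ℝ × ℝ => q0 p.1 p.2.1 p.2.2)
      {p : ℝ × ℝ × ℝ | 0 < p.2.1 ∧ p.2.1 < Real.pi} ∧
    ∀ t φ : ℝ, ∀ ϑ ∈ Ioo (0 : ℝ) Real.pi,
      Tendsto (fun r => U (t, r, ϑ, φ)) atTop (𝓝 (q0 t ϑ φ)) ∧
      Tendsto (fun r => dirD eT U (t, r, ϑ, φ)) atTop (𝓝 (deriv (fun s => q0 s ϑ φ) t)) ∧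
      Tendsto (fun r => dirD eTh U (t, r, ϑ, φ)) atTop (𝓝 (deriv (fun s => q0 t s φ) ϑ)) ∧
      Tendsto (fun r => dirD ePh U (t, r, ϑ, φ)) atTop (𝓝 (deriv (fun s => q0 t ϑ s) φ))

theorem eventually_mem_OmSet (rp t φ : ℝ) {ϑ : ℝ} (hϑ : ϑ ∈ Ioo (0 : ℝ) Real.pi) :
    ∀ᶠ r : ℝ in atTop, (t, r, ϑ, φ) ∈ OmSet rp := by
  filter_upwards [eventually_gt_atTop rp] with r hr using ⟨hr, hϑ.1, hϑ.2⟩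

theorem tendsto_congr_OmSet {rp : ℝ} {U V : E4 → ℂ} (h : EqOn U V (OmSet rp)) {t φ ϑ : ℝ}
    (hϑ : ϑ ∈ Ioo (0 : ℝ) Real.pi) {l : ℂ}
    (hU : Tendsto (fun r => U (t, r, ϑ, φ)) atTop (𝓝 l)) :
    Tendsto (fun r => V (t, r, ϑ, φ)) atTop (𝓝 l) :=
  hU.congr' ((eventually_mem_OmSet rp t φ hϑ).mono fun _ hr => h hr)

theorem TZ.congr {rp : ℝ} {U V : E4 → ℂ} (hU : TZ U) (h : EqOn U V (OmSet rp)) : TZ V :=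
  fun t φ _ hϑ => tendsto_congr_OmSet h hϑ (hU t φ _ hϑ)

theorem NiceU.tendsto {U : E4 → ℂ} (hU : NiceU U) {t φ ϑ : ℝ} (hϑ : ϑ ∈ Ioo (0 : ℝ) Real.pi) :
    ∃ l, Tendsto (fun r => U (t, r, ϑ, φ)) atTop (𝓝 l) := by
  obtain ⟨q, -, h⟩ := hU
  exact ⟨_, (h t φ ϑ hϑ).1⟩

/-- Two functions with the same limit at infinity have first derivatives with the same limits. -/
theorem NiceU.dirD_sub {U V : E4 → ℂ} (hU : NiceU U) (hV : NiceU V)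
    (h : TZ (fun p => U p - V p)) :
    TZ (fun p => dirD eT U p - dirD eT V p) ∧ TZ (fun p => dirD eTh U p - dirD eTh V p) ∧
      TZ (fun p => dirD ePh U p - dirD ePh V p) := by
  obtain ⟨q, -, hq⟩ := hU
  obtain ⟨q', -, hq'⟩ := hV
  have heq : ∀ t φ : ℝ, ∀ ϑ ∈ Ioo (0 : ℝ) Real.pi, q t ϑ φ = q' t ϑ φ := fun t φ ϑ hϑ =>
    sub_eq_zero.1 (tendsto_nhds_unique ((hq t φ ϑ hϑ).1.sub (hq' t φ ϑ hϑ).1) (h t φ ϑ hϑ))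
  refine ⟨fun t φ ϑ hϑ => ?_, fun t φ ϑ hϑ => ?_, fun t φ ϑ hϑ => ?_⟩
  · have e : (fun s => q s ϑ φ) = fun s => q' s ϑ φ := funext fun s => heq s φ ϑ hϑ
    have := (hq t φ ϑ hϑ).2.1.sub (hq' t φ ϑ hϑ).2.1
    rwa [e, sub_self] at this
  · have e : (fun s => q t s φ) =ᶠ[𝓝 ϑ] fun s => q' t s φ := by
      filter_upwards [isOpen_Ioo.mem_nhds hϑ] with s hs using heq t φ s hs
    have := (hq t φ ϑ hϑ).2.2.1.sub (hq' t φ ϑ hϑ).2.2.1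
    rwa [e.deriv_eq, sub_self] at this
  · have e : (fun s => q t ϑ s) = fun s => q' t ϑ s := funext fun s => heq t s ϑ hϑ
    have := (hq t φ ϑ hϑ).2.2.2.sub (hq' t φ ϑ hϑ).2.2.2
    rwa [e, sub_self] at this

theorem tendsto_mmR (M : ℝ) : Tendsto (fun r => (mmR M r : ℂ)) atTop (𝓝 0) := by
  have : Tendsto (fun r => mmR M r) atTop (𝓝 0) := tendsto_const_nhds.div_atTop tendsto_id
  simpa [Function.comp_def] using (Complex.continuous_ofReal.tendsto 0).comp this

theorem tendsto_ffR (M : ℝ) : Tendsto (fun r => (ffR M r : ℂ)) atTop (𝓝 0) := by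
  have h1 : Tendsto (fun r : ℝ => r⁻¹) atTop (𝓝 0) := tendsto_inv_atTop_zero
  have : Tendsto (fun r => ffR M r) atTop (𝓝 0) := by
    have h2 : Tendsto (fun r : ℝ => 6 * M * (r⁻¹ * r⁻¹) - 2 * r⁻¹) atTop (𝓝 0) := by
      simpa using ((h1.mul h1).const_mul (6 * M)).sub (h1.const_mul 2)
    refine h2.congr' ?_
    filter_upwards [eventually_gt_atTop (0 : ℝ)] with r hr
    unfold ffR
    field_simp
  simpa [Function.comp_def] using (Complex.continuous_ofReal.tendsto 0).comp this

theorem tendsto_ww_inv (M : ℝ) {k : ℝ} (hk : 0 < k) :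
    Tendsto (fun r => (ww M k r : ℂ)⁻¹) atTop (𝓝 ((k ^ 2 : ℝ) : ℂ)⁻¹) := by
  have h1 : Tendsto (fun r : ℝ => r⁻¹) atTop (𝓝 0) := tendsto_inv_atTop_zero
  have : Tendsto (fun r => ww M k r) atTop (𝓝 (k ^ 2)) := by
    have h2 : Tendsto (fun r : ℝ => r⁻¹ * r⁻¹ + k ^ 2 - 2 * M * (r⁻¹ * r⁻¹ * r⁻¹)) atTop
        (𝓝 (k ^ 2)) := by
      simpa using ((h1.mul h1).add_const (k ^ 2)).sub (((h1.mul h1).mul h1).const_mul (2 * M))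
    refine h2.congr' ?_
    filter_upwards [eventually_gt_atTop (0 : ℝ)] with r hr
    unfold ww Del
    field_simp
  exact ((Complex.continuous_ofReal.tendsto _).comp this).inv₀
    (Complex.ofReal_ne_zero.2 (by positivity))

/-- If `U` tends to zero at infinity together with its first angular derivatives and `𝓛U` has a
continuous limit, then that limit is zero. -/
theorem angU_tendsto_zero {rp : ℝ} {U : E4 → ℂ} (hU : Sm rp U) (h0 : TZ U)
    (hTh : TZ (dirD eTh U)) (hPh : TZ (dirD ePh U)) {G : ℝ → ℝ → ℝ → ℂ}
    (hG : ∀ t, ContinuousOn (fun q : ℝ × ℝ => G t q.1 q.2) {q | 0 < q.1 ∧ q.1 < Real.pi})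
    (h : ∀ t φ : ℝ, ∀ ϑ ∈ Ioo (0 : ℝ) Real.pi,
      Tendsto (fun r => angU U (t, r, ϑ, φ)) atTop (𝓝 (G t ϑ φ))) : TZ (angU U) := by
  intro t φ ϑ hϑ
  set V : Set (ℝ × ℝ) := {q | 0 < q.1 ∧ q.1 < Real.pi} with hVdef
  have hV : IsOpen V :=
    (isOpen_lt continuous_const continuous_fst).inter (isOpen_lt continuous_fst continuous_const)
  let ρ : ℕ → ℝ := fun n => rp + 1 + n
  have hρ : Tendsto ρ atTop atTop :=
    tendsto_atTop_add_const_left _ _ tendsto_natCast_atTop_atTop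
  let ι : ℕ → ℝ × ℝ → E4 := fun n q => (t, ρ n, q)
  have hι : ∀ n, ∀ q ∈ V, ι n q ∈ OmSet rp := fun n q hq => by
    refine ⟨?_, hq.1, hq.2⟩
    have : (0 : ℝ) ≤ n := n.cast_nonneg
    simp only [ι, ρ]; linarith
  let J : ℝ × ℝ →L[ℝ] E4 :=
    (0 : ℝ × ℝ →L[ℝ] ℝ).prod ((0 : ℝ × ℝ →L[ℝ] ℝ).prod (ContinuousLinearMap.id ℝ (ℝ × ℝ)))
  have hιd : ∀ n q, HasFDerivAt (ι n) J q := fun n q =>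
    (hasFDerivAt_const t q).prodMk ((hasFDerivAt_const (ρ n) q).prodMk (hasFDerivAt_id q))
  have hs0 : ∀ q ∈ V, (Real.sin q.1 : ℂ) ≠ 0 := fun q hq =>
    Complex.ofReal_ne_zero.2 (Real.sin_pos_of_pos_of_lt_pi hq.1 hq.2).ne'
  let S : E4 → ℂ := fun p => (Real.sin p.2.2.1 : ℂ)
  have hS : Sm rp S := Sm.ofReal (contDiffOn_sin_coord rp)
  have hC : Sm rp (fun p => (Real.cos p.2.2.1 : ℂ)) := Sm.ofReal (contDiffOn_cos_coord rp)
  have hSi : Sm rp (fun p => (S p)⁻¹) := ContDiffOn.inv hS fun p hp =>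
    Complex.ofReal_ne_zero.2 (sin_ne_zero_of_mem hp)
  let PU : E4 → ℂ := fun p => S p * dirD eTh U p
  let QU : E4 → ℂ := fun p => (S p)⁻¹ * dirD ePh U p
  have hPU : Sm rp PU := hS.mul (hU.dirD eTh)
  have hQU : Sm rp QU := hSi.mul (hU.dirD ePh)
  have hdP : ∀ p ∈ OmSet rp, dirD eTh PU p =
      (Real.cos p.2.2.1 : ℂ) * dirD eTh U p + S p * dirD eTh (dirD eTh U) p := fun p hp => by
    refine hPU.dirD_eq hp ?_
    have h1 : HasDerivAt (fun s : ℝ => S (p + s • eTh)) (Real.cos p.2.2.1 : ℂ) 0 := by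
      have hl : HasDerivAt (fun s : ℝ => p.2.2.1 + s) 1 0 := (hasDerivAt_id 0).const_add _
      have hsin : HasDerivAt Real.sin (Real.cos p.2.2.1) (p.2.2.1 + 0) := by
        simpa using Real.hasDerivAt_sin p.2.2.1
      have := (hsin.comp (0 : ℝ) hl).ofReal_comp
      simpa [S, eTh, Function.comp_def] using this
    refine (h1.mul ((hU.dirD eTh).hasDerivAt_line hp eTh)).congr_deriv ?_
    simp
  have hdQ : ∀ p ∈ OmSet rp, dirD ePh QU p = (S p)⁻¹ * dirD ePh (dirD ePh U) p := fun p hp => by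
    refine hQU.dirD_eq hp ?_
    have hϑ : ∀ s : ℝ, S (p + s • ePh) = S p := fun s => by simp [S, ePh]
    simp only [QU, hϑ]
    exact ((hU.dirD ePh).hasDerivAt_line hp ePh).const_mul _
  have chain : ∀ {F : E4 → ℂ}, Sm rp F → ∀ n, ∀ q ∈ V,
      HasFDerivAt (fun q => F (ι n q)) ((fderiv ℝ F (ι n q)).comp J) q := fun hF n q hq =>
    (hF.differentiableAt (hι n q hq)).hasFDerivAt.comp q (hιd n q)
  have hdiv : ∀ n, ∀ q ∈ V, fderiv ℝ (fun q => PU (ι n q)) q (1, 0)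
      + fderiv ℝ (fun q => QU (ι n q)) q (0, 1) = dirD eTh PU (ι n q) + dirD ePh QU (ι n q) := by
    intro n q hq
    rw [(chain hPU n q hq).fderiv, (chain hQU n q hq).fderiv]
    rfl
  have hseq : ∀ {F : E4 → ℂ} {q : ℝ × ℝ} {l : ℂ},
      Tendsto (fun r => F (t, r, q.1, q.2)) atTop (𝓝 l) →
      Tendsto (fun n => F (ι n q)) atTop (𝓝 l) := fun hF => hF.comp hρ
  have hcont : ContinuousOn (fun q : ℝ × ℝ => -((Real.sin q.1 : ℂ) * G t q.1 q.2)) V :=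
    ((Complex.continuous_ofReal.comp (Real.continuous_sin.comp
      continuous_fst)).continuousOn.mul (hG t)).neg
  have key := eq_zero_of_tendsto_divergence hV (P := fun n q => PU (ι n q))
    (Q := fun n q => QU (ι n q)) (h := fun q => -((Real.sin q.1 : ℂ) * G t q.1 q.2))
    (fun n q hq => (chain hPU n q hq).differentiableAt)
    (fun n q hq => (chain hQU n q hq).differentiableAt)
    (fun n => by
      have hc : ContinuousOn (fun p => dirD eTh PU p + dirD ePh QU p) (OmSet rp) :=
        ((hPU.dirD eTh).add (hQU.dirD ePh)).continuousOn
      refine ContinuousOn.congr ?_ (hdiv n)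
      exact hc.comp (fun q _ => (hιd n q).continuousAt.continuousWithinAt) (hι n))
    (fun q hq => by
      simpa [PU, S, ι] using (hseq (hTh t q.2 q.1 hq)).const_mul (Real.sin q.1 : ℂ))
    (fun q hq => by
      simpa [QU, S, ι] using (hseq (hPh t q.2 q.1 hq)).const_mul (Real.sin q.1 : ℂ)⁻¹)
    (fun q hq => by
      have hlim := ((((hseq (h t q.2 q.1 hq)).neg.sub ((hseq (hPh t q.2 q.1 hq)).const_mul
        (4 * Complex.I * ((Real.cos q.1 / (Real.sin q.1) ^ 2 : ℝ) : ℂ)))).add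
        ((hseq (h0 t q.2 q.1 hq)).const_mul
          (4 * (((Real.cos q.1 / Real.sin q.1) ^ 2 : ℝ) : ℂ) + 4))).const_mul
        (Real.sin q.1 : ℂ))
      have e : (Real.sin q.1 : ℂ) * (-G t q.1 q.2 - 4 * Complex.I *
          ((Real.cos q.1 / (Real.sin q.1) ^ 2 : ℝ) : ℂ) * 0
          + (4 * (((Real.cos q.1 / Real.sin q.1) ^ 2 : ℝ) : ℂ) + 4) * 0)
          = -((Real.sin q.1 : ℂ) * G t q.1 q.2) := by ring
      rw [e] at hlim
      refine hlim.congr fun n => ?_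
      rw [hdiv n q hq, hdP _ (hι n q hq), hdQ _ (hι n q hq)]
      have hs := hs0 q hq
      simp only [angU, S, ι, Complex.ofReal_div, Complex.ofReal_pow]
      field_simp
      ring)
    hcont (ϑ, φ) hϑ
  have hz : G t ϑ φ = 0 := by
    have := neg_eq_zero.1 key
    exact (mul_eq_zero.1 this).resolve_left (hs0 (ϑ, φ) hϑ)
  simpa [hz] using h t φ ϑ hϑ


namespace TZ

variable {U V : E4 → ℂ}

theorem add (hU : TZ U) (hV : TZ V) : TZ (fun p => U p + V p) := fun t φ ϑ hϑ => by
  simpa using (hU t φ ϑ hϑ).add (hV t φ ϑ hϑ)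

theorem sub (hU : TZ U) (hV : TZ V) : TZ (fun p => U p - V p) := fun t φ ϑ hϑ => by
  simpa using (hU t φ ϑ hϑ).sub (hV t φ ϑ hϑ)

theorem radial_mul {g : ℝ → ℂ} {l : ℂ} (hU : TZ U) (hg : Tendsto g atTop (𝓝 l)) :
    TZ (fun p => g p.2.1 * U p) := fun t φ ϑ hϑ => by
  simpa using hg.mul (hU t φ ϑ hϑ)

theorem const_mul (hU : TZ U) (c : ℂ) : TZ (fun p => c * U p) :=
  hU.radial_mul (tendsto_const_nhds (x := c))

end TZ

theorem NiceU.radial_mul {U : E4 → ℂ} {g : ℝ → ℂ} (hU : NiceU U) (hg : Tendsto g atTop (𝓝 0)) :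
    TZ (fun p => g p.2.1 * U p) := fun t φ ϑ hϑ => by
  obtain ⟨l, hl⟩ := hU.tendsto (t := t) (φ := φ) hϑ
  simpa using hg.mul hl

theorem NiceU.continuous_limit {U : E4 → ℂ} (hU : NiceU U) : ∃ q : ℝ → ℝ → ℝ → ℂ,
    (∀ t, ContinuousOn (fun z : ℝ × ℝ => q t z.1 z.2) {z | 0 < z.1 ∧ z.1 < Real.pi}) ∧
    ∀ t φ : ℝ, ∀ ϑ ∈ Ioo (0 : ℝ) Real.pi,
      Tendsto (fun r => U (t, r, ϑ, φ)) atTop (𝓝 (q t ϑ φ)) := by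
  obtain ⟨q, hq, h⟩ := hU
  refine ⟨q, fun t => ?_, fun t φ ϑ hϑ => (h t φ ϑ hϑ).1⟩
  exact hq.continuousOn.comp (f := fun z : ℝ × ℝ => (t, z)) (by fun_prop) fun z hz => hz

theorem Sm.angU_iterate {rp : ℝ} {U : E4 → ℂ} (hU : Sm rp U) (n : ℕ) : Sm rp (Grav.angU^[n] U) := by
  induction n with
  | zero => exact hU
  | succ n ih => rw [Function.iterate_succ_apply']; exact ih.angU

theorem angU_iterate_comb {rp : ℝ} {W U₁ U₂ U₃ : E4 → ℂ} {g₁ g₂ g₃ g₁' g₂' g₃' : ℝ → ℂ}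
    (hW : Sm rp W) (h₁ : Sm rp U₁) (h₂ : Sm rp U₂) (h₃ : Sm rp U₃)
    (hg₁ : ∀ r > rp, HasDerivAt g₁ (g₁' r) r) (hg₂ : ∀ r > rp, HasDerivAt g₂ (g₂' r) r)
    (hg₃ : ∀ r > rp, HasDerivAt g₃ (g₃' r) r)
    (h : EqOn W (fun p => g₁ p.2.1 * U₁ p + g₂ p.2.1 * U₂ p + g₃ p.2.1 * U₃ p) (OmSet rp))
    (n : ℕ) :
    EqOn (angU^[n] W) (fun p => g₁ p.2.1 * angU^[n] U₁ p + g₂ p.2.1 * angU^[n] U₂ p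
      + g₃ p.2.1 * angU^[n] U₃ p) (OmSet rp) := by
  induction n with
  | zero => exact h
  | succ n ih =>
    simp only [Function.iterate_succ_apply']
    exact angU_comb (hW.angU_iterate n) (h₁.angU_iterate n) (h₂.angU_iterate n)
      (h₃.angU_iterate n) hg₁ hg₂ hg₃ ih

theorem angU_iterate_const_comb {rp : ℝ} {U V : E4 → ℂ} (hU : Sm rp U) (hV : Sm rp V) (c : ℂ)
    (n : ℕ) :
    EqOn (angU^[n] (fun p => U p + c * V p)) (fun p => angU^[n] U p + c * angU^[n] V p)
      (OmSet rp) := fun p hp => by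
  have := angU_iterate_comb (g₁ := fun _ => 1) (g₂ := fun _ => c) (g₃ := fun _ => 0)
    (g₁' := fun _ => 0) (g₂' := fun _ => 0) (g₃' := fun _ => 0)
    (hU.add ((Sm.const c).mul hV)) hU hV hV (fun r _ => hasDerivAt_const r _)
    (fun r _ => hasDerivAt_const r _) (fun r _ => hasDerivAt_const r _)
    (fun p _ => by simp) n hp
  simpa using this

theorem angU_iterate_sub {rp : ℝ} {U V : E4 → ℂ} (hU : Sm rp U) (hV : Sm rp V) (n : ℕ) :
    EqOn (angU^[n] (fun p => U p - V p)) (fun p => angU^[n] U p - angU^[n] V p)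
      (OmSet rp) := fun p hp => by
  have := angU_iterate_const_comb hU hV (-1) n hp
  simpa [sub_eq_add_neg] using this

theorem dirD_angU_iterate {rp : ℝ} {U : E4 → ℂ} (hU : Sm rp U) {e : E4} (he : e.2.2.1 = 0)
    (n : ℕ) : EqOn (dirD e (angU^[n] U)) (angU^[n] (dirD e U)) (OmSet rp) := by
  induction n with
  | zero => exact fun _ _ => rfl
  | succ n ih =>
    simp only [Function.iterate_succ_apply']
    exact (dirD_angU (hU.angU_iterate n) he).trans (angU_congr ih)

theorem dirD_sub {rp : ℝ} {U V : E4 → ℂ} (hU : Sm rp U) (hV : Sm rp V) (e : E4) :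
    EqOn (dirD e (fun p => U p - V p)) (fun p => dirD e U p - dirD e V p) (OmSet rp) :=
  fun p hp => by
  simp only [dirD, fderiv_fun_sub (hU.differentiableAt hp) (hV.differentiableAt hp)]
  rfl

theorem ccR_eq {M k rp : ℝ} (hrp : 0 < rp) {p : E4} (hp : p ∈ OmSet rp) :
    (ccR M k p.2.1 : ℂ) = (ww M k p.2.1 : ℂ) * ((p.2.1 ^ 2 : ℝ) : ℂ) := by
  have hr : p.2.1 ≠ 0 := (hrp.trans hp.1).ne'
  rw [← Complex.ofReal_mul]
  unfold ccR ww
  congr 1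
  field_simp

/-- The boundary conditions at infinity for the Chandrasekhar transforms, with `b`, `y`, `Y` the
conjugates of the quantities of spin `-2`. -/
theorem chandrasekhar_boundary_conditions {M k rp : ℝ} (hM : 0 < M) (hk : 0 < k) (hrp : 0 < rp)
    (hroot : rp + k ^ 2 * rp ^ 3 - 2 * M = 0) {a b x y X Y : E4 → ℂ} (ha : Sm rp a)
    (hb : Sm rp b) (hx : Sm rp x) (hy : Sm rp y) (hX : Sm rp X) (hY : Sm rp Y)
    (h1a : EqOn (opU M k (-1) a) (fun p => (ww M k p.2.1 : ℂ) * x p) (OmSet rp))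
    (h2a : EqOn (opU M k (-1) x) (fun p => (ww M k p.2.1 : ℂ) * X p) (OmSet rp))
    (h1b : EqOn (opU M k 1 b) (fun p => (ww M k p.2.1 : ℂ) * y p) (OmSet rp))
    (h2b : EqOn (opU M k 1 y) (fun p => (ww M k p.2.1 : ℂ) * Y p) (OmSet rp))
    (hTa : ∀ p ∈ OmSet rp, opU M k 1 (opU M k (-1) a) p
      - 2 * (ffR M p.2.1 : ℂ) * opU M k (-1) a p
      + (ww M k p.2.1 : ℂ) * (angU a p - 2 * a p + (mmR M p.2.1 : ℂ) * a p) = 0)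
    (hTb : ∀ p ∈ OmSet rp, opU M k 1 (opU M k (-1) b) p
      + 2 * (ffR M p.2.1 : ℂ) * opU M k 1 b p
      + (ww M k p.2.1 : ℂ) * (angU b p - 2 * b p + (mmR M p.2.1 : ℂ) * b p) = 0)
    (na : ∀ n ≤ 2, NiceU (angU^[n] a)) (nb : ∀ n ≤ 2, NiceU (angU^[n] b))
    (nx : ∀ n ≤ 2, NiceU (angU^[n] x)) (ny : ∀ n ≤ 2, NiceU (angU^[n] y))
    (nX : NiceU (angU^[2] (opU M k 1 X))) (nY : NiceU (angU^[2] (opU M k (-1) Y)))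
    (zd : ∀ n ≤ 2, TZ (angU^[n] (fun p => a p - b p)))
    (zdT : ∀ n ≤ 2, TZ (dirD eT (angU^[n] (fun p => a p - b p))))
    (zD : ∀ n ≤ 2, TZ (angU^[n] (fun p => ((p.2.1 ^ 2 : ℝ) : ℂ) * dirD eR a p
      + ((p.2.1 ^ 2 : ℝ) : ℂ) * dirD eR b p))) :
    TZ (fun p => x p - y p) ∧
    TZ (fun p => ((p.2.1 ^ 2 : ℝ) : ℂ) * dirD eR x p + ((p.2.1 ^ 2 : ℝ) : ℂ) * dirD eR y p) ∧
    TZ (fun p => X p - Y p) ∧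
    TZ (fun p => opU M k 1 (opU M k 1 X) p + opU M k (-1) (opU M k (-1) Y) p
      + ((6 * M : ℝ) : ℂ)⁻¹ * angU (fun p => angU (fun p => opU M k 1 X p - opU M k (-1) Y p) p
        - 2 * (opU M k 1 X p - opU M k (-1) Y p)) p) := by
  have hw0 : ∀ p ∈ OmSet rp, (ww M k p.2.1 : ℂ) ≠ 0 := fun p hp =>
    Complex.ofReal_ne_zero.2 (ww_pos hrp hroot hp.1).ne'
  obtain ⟨E1a, E2a, E3a⟩ := chandrasekhar_identities hrp hroot ha hx hX (ε := 1) (by norm_num)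
    h1a h2a (by simpa using hTa)
  obtain ⟨E1b, E2b, E3b⟩ := chandrasekhar_identities hrp hroot hb hy hY (ε := -1) (by norm_num)
    (by simpa using h1b) (by simpa using h2b) (fun p hp => by
      rw [neg_neg, ← opU_comm hrp hb 1 (-1) hp]
      linear_combination hTb p hp)
  have hd : Sm rp (fun p => a p - b p) := ha.sub hb
  have hδ : Sm rp (fun p => x p - y p) := hx.sub hy
  have hr2 : Sm rp (fun p => ((p.2.1 ^ 2 : ℝ) : ℂ)) :=
    Sm.radial (f := fun r => r ^ 2) (by fun_prop)
  have hD : Sm rp (fun p => ((p.2.1 ^ 2 : ℝ) : ℂ) * dirD eR a p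
      + ((p.2.1 ^ 2 : ℝ) : ℂ) * dirD eR b p) :=
    (hr2.mul (ha.dirD eR)).add (hr2.mul (hb.dirD eR))
  have zδ : ∀ n ≤ 2, TZ (angU^[n] (fun p => x p - y p)) := fun n hn => by
    have h := angU_iterate_comb (g₁ := fun r => (ww M k r : ℂ)⁻¹) (g₂ := fun _ => -1)
      (g₃ := fun _ => 0) (g₂' := fun _ => 0) (g₃' := fun _ => 0) hδ (hd.dirD eT) hD hD
      (fun r hr => (hasDerivAt_ww M k (hrp.trans hr)).inv
        (Complex.ofReal_ne_zero.2 (ww_pos hrp hroot hr).ne'))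
      (fun r _ => hasDerivAt_const r _) (fun r _ => hasDerivAt_const r _)
      (fun p hp => by
        have e1 := h1a hp
        have e2 := h1b hp
        have hw := hw0 p hp
        simp only [opU, ccR_eq hrp hp] at e1 e2
        beta_reduce
        rw [dirD_sub ha hb eT hp]
        field_simp
        linear_combination e2 - e1) n
    refine (((zdT n hn).radial_mul (tendsto_ww_inv M hk)).sub (zD n hn)).congr (rp := rp)
      fun p hp => ?_
    rw [h hp]
    beta_reduce
    rw [dirD_angU_iterate hd rfl n hp]
    ring
  have zδ0 : TZ (fun p => x p - y p) := zδ 0 (by norm_num)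
  have zd0 : TZ (fun p => a p - b p) := zd 0 (by norm_num)
  have zδT : TZ (fun p => dirD eT x p - dirD eT y p) :=
    ((nx 0 (by norm_num)).dirD_sub (ny 0 (by norm_num)) zδ0).1
  have zr : TZ (fun p => (ww M k p.2.1 : ℂ) * (((p.2.1 ^ 2 : ℝ) : ℂ) * dirD eR x p
      + ((p.2.1 ^ 2 : ℝ) : ℂ) * dirD eR y p)) := by
    refine ((((((nx 0 (by norm_num)).radial_mul (tendsto_ffR M)).add
      ((ny 0 (by norm_num)).radial_mul (tendsto_ffR M))).sub (zd 1 (by norm_num))).add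
      (zd0.const_mul 2)).sub (zd0.radial_mul (tendsto_mmR M)) |>.sub zδT).congr (rp := rp)
      fun p hp => ?_
    have e1 := E1a hp
    have e2 := E1b hp
    have e3 := angU_iterate_sub ha hb 1 hp
    simp only [opU, ccR_eq hrp hp] at e1 e2
    simp only [Function.iterate_one, Function.iterate_zero, id_eq] at e3 ⊢
    rw [e3]
    linear_combination e2 - e1
  have winv_cancel : ∀ {U : E4 → ℂ}, TZ (fun p => (ww M k p.2.1 : ℂ) * U p) → TZ U :=
    fun h => (h.radial_mul (tendsto_ww_inv M hk)).congr (rp := rp) fun p hp =>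
      inv_mul_cancel_left₀ (hw0 p hp) _
  refine ⟨zδ0, winv_cancel zr, winv_cancel ((zδT.sub zr).congr (rp := rp) fun p hp => ?_), ?_⟩
  · have e1 := h2a hp
    have e2 := h2b hp
    simp only [opU, ccR_eq hrp hp] at e1 e2
    beta_reduce
    linear_combination e1 - e2
  set Q : E4 → ℂ := fun p => opU M k 1 X p - opU M k (-1) Y p with hQdef
  set δ : E4 → ℂ := fun p => x p - y p with hδdef
  have hs : Sm rp (fun p => a p + b p) := ha.add hb
  have hQ : Sm rp Q := (hX.opU hrp 1).sub (hY.opU hrp (-1))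
  have δ1 := angU_iterate_sub hx hy 1
  have s_iter : ∀ n, EqOn (angU^[n] (fun p => a p + b p))
      (fun p => angU^[n] a p + angU^[n] b p) (OmSet rp) := fun n p hp => by
    simpa using angU_iterate_const_comb ha hb 1 n hp
  have Q_iter : ∀ n, EqOn (angU^[n] Q) (fun p => - angU^[n + 1] δ p
      + (mmR M p.2.1 : ℂ) * angU^[n] δ p - 6 * M * (angU^[n] a p + angU^[n] b p))
      (OmSet rp) := fun n p hp => by
    have := angU_iterate_comb (g₁ := fun _ => -1) (g₂ := fun r => (mmR M r : ℂ))
      (g₃ := fun _ => - (6 * M)) (g₁' := fun _ => 0) (g₃' := fun _ => 0) hQ hδ.angU hδ hs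
      (fun r _ => hasDerivAt_const r _) (fun r hr => hasDerivAt_mmR M (hrp.trans hr))
      (fun r _ => hasDerivAt_const r _) (fun p hp => by
        have e1 := E2a hp
        have e2 := E2b hp
        have e3 := δ1 hp
        simp only [Function.iterate_one] at e3
        simp only [hQdef]
        rw [e1, e2, e3]
        simp only [hδdef]
        ring) n hp
    rw [this, Function.iterate_succ_apply]
    beta_reduce
    rw [s_iter n hp]
    ring
  have zδ3 : TZ (angU (angU^[2] δ)) := by
    obtain ⟨q1, c1, l1⟩ := nX.continuous_limit
    obtain ⟨q2, c2, l2⟩ := nY.continuous_limit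
    obtain ⟨q3, c3, l3⟩ := (na 2 le_rfl).continuous_limit
    obtain ⟨q4, c4, l4⟩ := (nb 2 le_rfl).continuous_limit
    have δ2 := angU_iterate_sub hx hy 2
    obtain ⟨-, zTh, zPh⟩ := (nx 2 le_rfl).dirD_sub (ny 2 le_rfl) ((zδ 2 le_rfl).congr δ2)
    have dδ2 : ∀ e, EqOn (fun p => dirD e (angU^[2] x) p - dirD e (angU^[2] y) p)
        (dirD e (angU^[2] δ)) (OmSet rp) := fun e =>
      ((dirD_congr δ2 e).trans (dirD_sub (hx.angU_iterate 2) (hy.angU_iterate 2) e)).symm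
    refine angU_tendsto_zero (hδ.angU_iterate 2) (zδ 2 le_rfl) (zTh.congr (dδ2 _))
      (zPh.congr (dδ2 _))
      (G := fun t ϑ φ => - q1 t ϑ φ + q2 t ϑ φ - 6 * M * (q3 t ϑ φ + q4 t ϑ φ))
      (fun t => (((c1 t).neg.add (c2 t)).sub
        (continuousOn_const.mul ((c3 t).add (c4 t)))))
      (fun t φ ϑ hϑ => ?_)
    have hm := ((zδ 2 le_rfl).radial_mul (tendsto_mmR M)) t φ ϑ hϑ
    have hlim := (((l1 t φ ϑ hϑ).neg.add (l2 t φ ϑ hϑ)).sub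
      (((l3 t φ ϑ hϑ).add (l4 t φ ϑ hϑ)).const_mul (6 * (M : ℂ)))).add hm
    rw [add_zero] at hlim
    refine hlim.congr' ((eventually_mem_OmSet rp t φ hϑ).mono fun r hr => ?_)
    have e1 := Q_iter 2 hr
    have e2 := angU_iterate_sub (hX.opU (M := M) (k := k) hrp 1)
      (hY.opU (M := M) (k := k) hrp (-1)) 2 hr
    rw [Function.iterate_succ_apply' angU 2 δ] at e1
    rw [← hQdef] at e2
    beta_reduce at e1 e2 ⊢
    linear_combination e2 - e1
  have hM0 : (M : ℂ) ≠ 0 := Complex.ofReal_ne_zero.2 hM.ne'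
  have hm := tendsto_mmR M
  have hf := tendsto_ffR M
  have z1 := zδ 1 (by norm_num)
  have z2 := zδ 2 le_rfl
  have hg : Tendsto (fun r => (mmR M r : ℂ) * (2 - (mmR M r : ℂ))) atTop (𝓝 0) := by
    simpa using hm.mul (hm.const_sub 2)
  have zs := ((na 0 (by norm_num)).radial_mul hg).add ((nb 0 (by norm_num)).radial_mul hg)
  have zdT0 : TZ (fun p => dirD eT a p - dirD eT b p) :=
    (zdT 0 (by norm_num)).congr (dirD_sub ha hb eT)
  refine (((((zδ0.radial_mul (hm.mul hf)).sub (z1.radial_mul hf)).add zs).sub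
    (zdT0.const_mul (12 * M))).add (((((z2.radial_mul hm).sub zδ3).add (z2.const_mul 2)).sub
    ((z1.radial_mul hm).const_mul 2)).const_mul ((6 * M : ℝ) : ℂ)⁻¹)).congr (rp := rp)
      fun p hp => ?_
  have e1 := E3a hp
  have e2 := E3b hp
  have e3 : angU (fun p => angU Q p - 2 * Q p) p = angU (angU Q) p - 2 * angU Q p := by
    simpa [sub_eq_add_neg] using angU_iterate_const_comb hQ.angU hQ (-2) 1 hp
  have e4 := Q_iter 2 hp
  have e5 := Q_iter 1 hp
  have e6 := δ1 hp
  simp only [Function.iterate_succ_apply', Function.iterate_zero, id_eq] at e4 e5 e6 ⊢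
  rw [e1, e2, e3, e4, e5, e6]
  simp only [hδdef]
  push_cast
  field_simp
  ring

/-- `U` is a smooth function agreeing with `u` on the exterior region. -/
def Rep (rp : ℝ) (u : F4) (U : E4 → ℂ) : Prop := EqOn (unc u) U (OmSet rp) ∧ Sm rp U

theorem SmoothOnOm.rep {rp : ℝ} {u : F4} (hu : SmoothOnOm rp u) : Rep rp u (unc u) :=
  ⟨fun _ _ => rfl, hu⟩

namespace Rep

variable {M k rp : ℝ} {u v : F4} {U V : E4 → ℂ}

theorem sm_unc (h : Rep rp u U) : Sm rp (unc u) := h.2.congr h.1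

theorem hasDerivAt_comp (h : Rep rp u U) {γ : ℝ → E4} {e : E4} {s : ℝ} (hγ : HasDerivAt γ e s)
    (hs : γ s ∈ OmSet rp) : HasDerivAt (fun σ => unc u (γ σ)) (dirD e U (γ s)) s := by
  refine ((h.2.differentiableAt hs).hasFDerivAt.comp_hasDerivAt s hγ).congr_of_eventuallyEq ?_
  filter_upwards [hγ.continuousAt.eventually_mem ((isOpen_OmSet rp).mem_nhds hs)] with σ hσ
    using h.1 hσ

theorem dT (h : Rep rp u U) : Rep rp (dT u) (dirD eT U) := by
  refine ⟨fun p hp => HasDerivAt.deriv ?_, h.2.dirD eT⟩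
  exact h.hasDerivAt_comp (γ := fun s => (s, p.2)) ((hasDerivAt_id p.1).prodMk
    (hasDerivAt_const p.1 p.2)) hp

theorem dR (h : Rep rp u U) : Rep rp (dR u) (dirD eR U) := by
  refine ⟨fun p hp => HasDerivAt.deriv ?_, h.2.dirD eR⟩
  exact h.hasDerivAt_comp (γ := fun s => (p.1, s, p.2.2)) ((hasDerivAt_const _ p.1).prodMk
    ((hasDerivAt_id p.2.1).prodMk (hasDerivAt_const _ p.2.2))) hp

theorem hasDerivAt_eTh (h : Rep rp u U) {p : E4} (hp : p ∈ OmSet rp) :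
    HasDerivAt (fun s => u p.1 p.2.1 s p.2.2.2) (dirD eTh U p) p.2.2.1 :=
  h.hasDerivAt_comp (γ := fun s => (p.1, p.2.1, s, p.2.2.2)) ((hasDerivAt_const _ p.1).prodMk
    ((hasDerivAt_const _ p.2.1).prodMk ((hasDerivAt_id p.2.2.1).prodMk
      (hasDerivAt_const _ p.2.2.2)))) hp

theorem dTh (h : Rep rp u U) : Rep rp (dTh u) (dirD eTh U) :=
  ⟨fun _ hp => (h.hasDerivAt_eTh hp).deriv, h.2.dirD eTh⟩

theorem dPh (h : Rep rp u U) : Rep rp (dPh u) (dirD ePh U) := by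
  refine ⟨fun p hp => HasDerivAt.deriv ?_, h.2.dirD ePh⟩
  exact h.hasDerivAt_comp (γ := fun s => (p.1, p.2.1, p.2.2.1, s)) ((hasDerivAt_const _ p.1).prodMk
    ((hasDerivAt_const _ p.2.1).prodMk ((hasDerivAt_const _ p.2.2.1).prodMk
      (hasDerivAt_id p.2.2.2)))) hp

theorem angP (h : Rep rp u U) : Rep rp (angP u) (angU U) := by
  refine ⟨fun p hp => ?_, h.2.angU⟩
  have hs : (Real.sin p.2.2.1 : ℂ) ≠ 0 := Complex.ofReal_ne_zero.2 (sin_ne_zero_of_mem hp)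
  have h0 := h.1 hp
  have h1 := h.dTh.1 hp
  have h2 := h.dPh.1 hp
  have h3 := h.dPh.dPh.1 hp
  have h4 := ((Real.hasDerivAt_sin p.2.2.1).ofReal_comp.mul (h.dTh.hasDerivAt_eTh hp)).deriv
  simp only [unc] at h0 h1 h2 h3
  have h5 : deriv (fun s => (Real.sin s : ℂ) * Grav.dTh u p.1 p.2.1 s p.2.2.2) p.2.2.1
      = (Real.cos p.2.2.1 : ℂ) * dirD eTh U p
        + (Real.sin p.2.2.1 : ℂ) * dirD eTh (dirD eTh U) p := by
    rw [← h1]; exact h4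
  simp only [unc, Grav.angP, angU]
  rw [h5, h0, h2, h3]
  push_cast at hs ⊢
  field_simp
  ring

theorem opL (hrp : 0 < rp) (h : Rep rp u U) : Rep rp (opL M k u) (opU M k 1 U) := by
  refine ⟨fun p hp => ?_, h.2.opU hrp 1⟩
  have h1 := h.dT.1 hp
  have h2 := h.dR.1 hp
  simp only [unc] at h1 h2
  simp only [unc, Grav.opL, opU, h1, h2, ccR, one_mul]

theorem opLb (hrp : 0 < rp) (h : Rep rp u U) : Rep rp (opLb M k u) (opU M k (-1) U) := by
  refine ⟨fun p hp => ?_, h.2.opU hrp (-1)⟩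
  have h1 := h.dT.1 hp
  have h2 := h.dR.1 hp
  simp only [unc] at h1 h2
  simp only [unc, Grav.opLb, opU, h1, h2, ccR]
  ring

theorem winv (hrp : 0 < rp) (hroot : rp + k ^ 2 * rp ^ 3 - 2 * M = 0) (h : Rep rp u U) :
    Rep rp (winv M k u) (fun p => (ww M k p.2.1 : ℂ)⁻¹ * U p) :=
  ⟨fun _ hp => congrArg _ (h.1 hp), (Sm.ww_inv hrp hroot).mul h.2⟩

theorem iterate {D : F4 → F4} {D' : (E4 → ℂ) → E4 → ℂ}
    (hD : ∀ {u U}, Rep rp u U → Rep rp (D u) (D' U)) (h : Rep rp u U) (n : ℕ) :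
    Rep rp (D^[n] u) (D'^[n] U) := by
  induction n with
  | zero => exact h
  | succ n ih =>
    simp only [Function.iterate_succ_apply']
    exact hD ih

theorem niceU (h : Rep rp u U) (hu : Nice u) : NiceU U := by
  obtain ⟨q, hq, hl⟩ := hu
  refine ⟨q, hq, fun t φ ϑ hϑ => ?_⟩
  obtain ⟨h0, h1, h2, h3⟩ := hl t φ ϑ hϑ
  exact ⟨tendsto_congr_OmSet h.1 hϑ h0, tendsto_congr_OmSet h.dT.1 hϑ h1,
    tendsto_congr_OmSet h.dTh.1 hϑ h2, tendsto_congr_OmSet h.dPh.1 hϑ h3⟩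

theorem tz (h : Rep rp u U) (hu : tends0 u) : TZ U := TZ.congr (U := unc u) hu h.1

end Rep

theorem TZ.tends0 {rp : ℝ} {u : F4} {U : E4 → ℂ} (hU : TZ U) (h : EqOn (unc u) U (OmSet rp)) :
    tends0 u := hU.congr h.symm

section conj

variable (u : F4)

theorem dT_conjF : dT (conjF u) = conjF (dT u) := by
  funext t r ϑ φ; exact deriv.star (f := fun s => u s r ϑ φ)

theorem dR_conjF : dR (conjF u) = conjF (dR u) := by
  funext t r ϑ φ; exact deriv.star (f := fun s => u t s ϑ φ)

theorem dTh_conjF : dTh (conjF u) = conjF (dTh u) := by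
  funext t r ϑ φ; exact deriv.star (f := fun s => u t r s φ)

theorem dPh_conjF : dPh (conjF u) = conjF (dPh u) := by
  funext t r ϑ φ; exact deriv.star (f := fun s => u t r ϑ s)

theorem opL_conjF (M k : ℝ) : opL M k (conjF u) = conjF (opL M k u) := by
  funext t r ϑ φ
  simp only [opL, dT_conjF, dR_conjF, conjF, map_add, map_mul, Complex.conj_ofReal]

theorem opLb_conjF (M k : ℝ) : opLb M k (conjF u) = conjF (opLb M k u) := by
  funext t r ϑ φ
  simp only [opLb, dT_conjF, dR_conjF, conjF, map_sub, map_mul, Complex.conj_ofReal]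

theorem winv_conjF (M k : ℝ) : winv M k (conjF u) = conjF (winv M k u) := by
  funext t r ϑ φ
  simp only [winv, conjF, map_mul, map_inv₀, Complex.conj_ofReal]

theorem angP_conjF : angP (conjF u) = conjF (angM u) := by
  funext t r ϑ φ
  have h : deriv (fun x => (Real.sin x : ℂ) * dTh (conjF u) t r x φ) ϑ
      = (starRingEnd ℂ) (deriv (fun x => (Real.sin x : ℂ) * dTh u t r x φ) ϑ) := by
    have e : (fun x => (Real.sin x : ℂ) * dTh (conjF u) t r x φ)
        = fun x => star ((Real.sin x : ℂ) * dTh u t r x φ) := by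
      funext x
      rw [dTh_conjF, ← starRingEnd_apply, map_mul, Complex.conj_ofReal]
      rfl
    rw [e]
    exact deriv.star
  simp only [angP, angM, h, dPh_conjF, conjF, map_add, map_sub, map_mul, map_neg, map_inv₀,
    Complex.conj_ofReal, Complex.conj_I, map_ofNat]
  ring

end conj

theorem SmoothOnOm.conjF {rp : ℝ} {u : F4} (hu : SmoothOnOm rp u) : SmoothOnOm rp (conjF u) :=
  Complex.conjCLE.contDiff.comp_contDiffOn hu

theorem wwP_div_ww {M k rp : ℝ} (hrp : 0 < rp) (hroot : rp + k ^ 2 * rp ^ 3 - 2 * M = 0) {r : ℝ}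
    (hr : rp < r) : wwP M k r / ww M k r = ffR M r := by
  have := (ww_pos hrp hroot hr).ne'
  unfold wwP ffR
  field_simp

/-- Boundary conditions at infinity for the Chandrasekhar
transformations of solutions of the Teukolsky system with the conformal AdS
boundary conditions. -/
theorem statement4
    (M k rp : ℝ) (hM : 0 < M) (hk : 0 < k) (hrp : 0 < rp)
    (hroot : rp + k ^ 2 * rp ^ 3 - 2 * M = 0)
    (αp αm : F4) (hαp : SmoothOnOm rp αp) (hαm : SmoothOnOm rp αm)
    (hTp : ∀ t r ϑ φ : ℝ, (t, r, ϑ, φ) ∈ OmSet rp → Tp M k αp t r ϑ φ = 0)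
    (hTm : ∀ t r ϑ φ : ℝ, (t, r, ϑ, φ) ∈ OmSet rp → Tm M k αm t r ϑ φ = 0)
    (ψp Ψp ψm Ψm : F4)
    (hψp : ψp = winv M k (opLb M k αp))
    (hΨp : Ψp = winv M k (opLb M k ψp))
    (hψm : ψm = winv M k (opL M k αm))
    (hΨm : Ψm = winv M k (opL M k ψm))
    -- (H1): regularity-at-infinity hypotheses
    (hH1 : ∀ j n : ℕ, j ≤ 3 → n ≤ 2 →
      ∀ q ∈ ({αp, conjF αm, ψp, conjF ψm, Ψp, conjF Ψm} : Set F4),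
        Nice (dT^[j] (angP^[n] q)) ∧ Nice (dT^[j] (angP^[n] (opL M k q))) ∧
          Nice (dT^[j] (angP^[n] (opLb M k q))))
    -- (H2): the conformal Teukolsky boundary conditions and their derivatives
    (hH2 : ∀ j n : ℕ, j ≤ 3 → n ≤ 2 →
      tends0 (dT^[j] (angP^[n] (fun t r ϑ φ => αp t r ϑ φ - conjF αm t r ϑ φ))) ∧
      tends0 (dT^[j] (angP^[n] (fun t r ϑ φ =>
        ((r ^ 2 : ℝ) : ℂ) * dR αp t r ϑ φ + ((r ^ 2 : ℝ) : ℂ) * dR (conjF αm) t r ϑ φ)))) :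
    -- (i)
    tends0 (fun t r ϑ φ => ψp t r ϑ φ - conjF ψm t r ϑ φ) ∧
    tends0 (fun t r ϑ φ =>
      ((r ^ 2 : ℝ) : ℂ) * dR ψp t r ϑ φ + ((r ^ 2 : ℝ) : ℂ) * dR (conjF ψm) t r ϑ φ) ∧
    -- (ii)
    tends0 (fun t r ϑ φ => Ψp t r ϑ φ - conjF Ψm t r ϑ φ) ∧
    -- (iii)
    tends0 (fun t r ϑ φ =>
      opL M k (opL M k Ψp) t r ϑ φ + opLb M k (opLb M k (conjF Ψm)) t r ϑ φ
        + ((6 * M : ℝ) : ℂ)⁻¹ *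
            angSqP (fun t r ϑ φ =>
              opL M k Ψp t r ϑ φ - opLb M k (conjF Ψm) t r ϑ φ) t r ϑ φ) := by
  have ra := hαp.rep
  have rb := hαm.conjF.rep
  have rx : Rep rp ψp (unc ψp) := by
    rw [hψp]; exact SmoothOnOm.rep ((ra.opLb hrp).winv hrp hroot).sm_unc
  have rX : Rep rp Ψp (unc Ψp) := by
    rw [hΨp]; exact SmoothOnOm.rep ((rx.opLb hrp).winv hrp hroot).sm_unc
  have hψm' : conjF ψm = winv M k (opL M k (conjF αm)) := by
    rw [hψm, opL_conjF, winv_conjF]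
  have hΨm' : conjF Ψm = winv M k (opL M k (conjF ψm)) := by
    rw [hΨm, opL_conjF, winv_conjF]
  have ry : Rep rp (conjF ψm) (unc (conjF ψm)) := by
    rw [hψm']; exact SmoothOnOm.rep ((rb.opL hrp).winv hrp hroot).sm_unc
  have rY : Rep rp (conjF Ψm) (unc (conjF Ψm)) := by
    rw [hΨm']; exact SmoothOnOm.rep ((ry.opL hrp).winv hrp hroot).sm_unc
  have unwinv : ∀ {u v : F4} {V : E4 → ℂ}, u = winv M k v → Rep rp v V →
      EqOn V (fun p => (ww M k p.2.1 : ℂ) * unc u p) (OmSet rp) := by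
    rintro u v V rfl hv p hp
    have hw : (ww M k p.2.1 : ℂ) ≠ 0 := Complex.ofReal_ne_zero.2 (ww_pos hrp hroot hp.1).ne'
    simp only [unc, winv]
    rw [mul_inv_cancel_left₀ hw]
    exact (hv.1 hp).symm
  have nice : ∀ {q : F4}, q ∈ ({αp, conjF αm, ψp, conjF ψm, Ψp, conjF Ψm} : Set F4) →
      Rep rp q (unc q) → ∀ n ≤ 2, NiceU (angU^[n] (unc q)) ∧
        NiceU (angU^[n] (opU M k 1 (unc q))) ∧ NiceU (angU^[n] (opU M k (-1) (unc q))) := by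
    intro q hq rq n hn
    obtain ⟨n1, n2, n3⟩ := hH1 0 n (by norm_num) hn q hq
    exact ⟨(rq.iterate Rep.angP n).niceU n1, ((rq.opL hrp).iterate Rep.angP n).niceU n2,
      ((rq.opLb hrp).iterate Rep.angP n).niceU n3⟩
  have rd : Rep rp (fun t r ϑ φ => αp t r ϑ φ - conjF αm t r ϑ φ)
      (fun p => unc αp p - unc (conjF αm) p) := ⟨fun _ _ => rfl, ra.2.sub rb.2⟩
  have rad : ∀ {u v : F4}, Rep rp u (unc u) → Rep rp v (unc v) →
      Rep rp (fun t r ϑ φ => ((r ^ 2 : ℝ) : ℂ) * dR u t r ϑ φ + ((r ^ 2 : ℝ) : ℂ) * dR v t r ϑ φ)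
        (fun p => ((p.2.1 ^ 2 : ℝ) : ℂ) * dirD eR (unc u) p
          + ((p.2.1 ^ 2 : ℝ) : ℂ) * dirD eR (unc v) p) := by
    intro u v hu hv
    have hr2 : Sm rp (fun p => ((p.2.1 ^ 2 : ℝ) : ℂ)) :=
      Sm.radial (f := fun r => r ^ 2) (by fun_prop)
    refine ⟨fun p hp => ?_, (hr2.mul (hu.2.dirD eR)).add (hr2.mul (hv.2.dirD eR))⟩
    have h1 := hu.dR.1 hp
    have h2 := hv.dR.1 hp
    simp only [unc] at h1 h2 ⊢
    rw [h1, h2]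
  obtain ⟨c1, c2, c3, c4⟩ := chandrasekhar_boundary_conditions hM hk hrp hroot ra.2 rb.2 rx.2 ry.2
    rX.2 rY.2 (unwinv hψp (ra.opLb hrp)) (unwinv hΨp (rx.opLb hrp)) (unwinv hψm' (rb.opL hrp))
    (unwinv hΨm' (ry.opL hrp))
    (fun p hp => by
      have h := hTp p.1 p.2.1 p.2.2.1 p.2.2.2 hp
      have h1 := ((ra.opLb (M := M) (k := k) hrp).opL (M := M) (k := k) hrp).1 hp
      have h2 := (ra.opLb (M := M) (k := k) hrp).1 hp
      have h3 := ra.angP.1 hp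
      rw [Tp, wwP_div_ww hrp hroot hp.1] at h
      simp only [unc] at h1 h2 h3 ⊢
      rw [h1, h2, h3] at h
      unfold mmR
      linear_combination -h)
    (fun p hp => by
      have h := congrArg (starRingEnd ℂ) (hTm p.1 p.2.1 p.2.2.1 p.2.2.2 hp)
      have h1 := ((rb.opLb (M := M) (k := k) hrp).opL (M := M) (k := k) hrp).1 hp
      have h2 := (rb.opL (M := M) (k := k) hrp).1 hp
      have h3 := rb.angP.1 hp
      rw [opLb_conjF, opL_conjF] at h1
      rw [opL_conjF] at h2
      rw [angP_conjF] at h3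
      rw [Tm, wwP_div_ww hrp hroot hp.1] at h
      simp only [map_add, map_sub, map_mul, map_neg, map_ofNat, map_zero,
        Complex.conj_ofReal] at h
      rw [← h1, ← h2, ← h3]
      simp only [unc, conjF, mmR]
      linear_combination -h)
    (fun n hn => (nice (by simp) ra n hn).1) (fun n hn => (nice (by simp) rb n hn).1)
    (fun n hn => (nice (by simp) rx n hn).1) (fun n hn => (nice (by simp) ry n hn).1)
    (nice (by simp) rX 2 le_rfl).2.1 (nice (by simp) rY 2 le_rfl).2.2
    (fun n hn => (rd.iterate Rep.angP n).tz (hH2 0 n (by norm_num) hn).1)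
    (fun n hn => (rd.iterate Rep.angP n).dT.tz (hH2 1 n (by norm_num) hn).1)
    (fun n hn => ((rad ra rb).iterate Rep.angP n).tz (hH2 0 n (by norm_num) hn).2)
  have rQ : Rep rp (fun t r ϑ φ => opL M k Ψp t r ϑ φ - opLb M k (conjF Ψm) t r ϑ φ)
      (fun p => opU M k 1 (unc Ψp) p - opU M k (-1) (unc (conjF Ψm)) p) :=
    ⟨fun p hp => congrArg₂ (· - ·) ((rX.opL hrp).1 hp) ((rY.opLb hrp).1 hp),
      (rX.opL hrp).2.sub (rY.opLb hrp).2⟩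
  have rQ2 : Rep rp (angSqP fun t r ϑ φ => opL M k Ψp t r ϑ φ - opLb M k (conjF Ψm) t r ϑ φ)
      (angU fun p => angU (fun p => opU M k 1 (unc Ψp) p - opU M k (-1) (unc (conjF Ψm)) p) p
        - 2 * (opU M k 1 (unc Ψp) p - opU M k (-1) (unc (conjF Ψm)) p)) :=
    Rep.angP ⟨fun p hp => congrArg₂ (fun z z' : ℂ => z - 2 * z') (rQ.angP.1 hp) (rQ.1 hp),
      rQ.angP.2.sub ((Sm.const 2).mul rQ.2)⟩
  refine ⟨c1, c2.tends0 (rad rx ry).1, c3, c4.tends0 (rp := rp) fun p hp => ?_⟩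
  have h1 := ((rX.opL (M := M) (k := k) hrp).opL (M := M) (k := k) hrp).1 hp
  have h2 := ((rY.opLb (M := M) (k := k) hrp).opLb (M := M) (k := k) hrp).1 hp
  beta_reduce
  rw [← h1, ← h2, ← rQ2.1 hp]
  rfl

end Grav
end
end
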